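/- arXiv:2501.10065 — 9 statements merged into one kernel-verified Lean document; each statement's English description precedes it below -/
import Mathlib

section
/- Let L ≥ 1 and let Γ_L = (ℤ/Lℤ)² with e₁ = (1,0) and e₂ = (0,1). Let σ, σ′ : Γ_L × {1,2} → {−1,1} be two assignments of spins to the bonds of Γ_L. For x ∈ Γ_L define the plaquette flux of σ at x as σ(x,1)·σ(x+e₁,2)·σ(x+e₂,1)·σ(x,2), the horizontal loop product as ∏_{n=0}^{L−1} σ((n,0),1), and the vertical loop product as ∏_{n=0}^{L−1} σ((0,n),2). Assume that σ and σ′ have the same plaquette flux at every x ∈ Γ_L, the same horizontal loop product, and the same vertical loop product. Then there exists φ : Γ_L → {−1,1} such that σ′(x,μ) = φ(x)·σ(x,μ)·φ(x+e_μ) for all x ∈ Γ_L and μ ∈ {1,2}. -/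
/-- The partial products of a function on `ℤ/Lℤ` whose total product is `1` form a periodic
primitive of that function. -/
theorem ZMod.prod_range_val_add_one {G : Type*} [CommGroup G] {L : ℕ} [NeZero L]
    (f : ZMod L → G) (hf : ∏ n ∈ Finset.range L, f n = 1) (a : ZMod L) :
    ∏ n ∈ Finset.range (a + 1).val, f n = (∏ n ∈ Finset.range a.val, f n) * f a := by
  have hsucc : (∏ n ∈ Finset.range a.val, f n) * f a = ∏ n ∈ Finset.range (a.val + 1), f n := by
    rw [Finset.prod_range_succ, ZMod.natCast_zmod_val]
  rw [hsucc]
  have hcast : a + 1 = ((a.val + 1 : ℕ) : ZMod L) := by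
    rw [Nat.cast_add, ZMod.natCast_zmod_val, Nat.cast_one]
  rw [hcast, ZMod.val_natCast]
  rcases (Nat.succ_le_of_lt a.val_lt).lt_or_eq with h | h
  · rw [Nat.mod_eq_of_lt h]
  · rw [← Nat.succ_eq_add_one, h, Nat.mod_self, Finset.prod_range_zero, hf]

/-- A flat connection on the discrete torus with values in a commutative group and with trivial
holonomy along the two coordinate loops is a pure gauge. -/
theorem exists_potential_of_flat {G : Type*} [CommGroup G] {L : ℕ} [NeZero L]
    (h v : ZMod L × ZMod L → G)
    (hflat : ∀ x, h x * v (x + (1, 0)) = v x * h (x + (0, 1)))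
    (hh : ∏ n ∈ Finset.range L, h ((n : ZMod L), 0) = 1)
    (hv : ∏ n ∈ Finset.range L, v (0, (n : ZMod L)) = 1) :
    ∃ φ : ZMod L × ZMod L → G,
      (∀ x, φ (x + (1, 0)) = φ x * h x) ∧ (∀ x, φ (x + (0, 1)) = φ x * v x) := by
  have transport (a : ZMod L) (n : ℕ) :
      h (a, 0) * ∏ i ∈ Finset.range n, v (a + 1, (i : ZMod L)) =
        (∏ i ∈ Finset.range n, v (a, (i : ZMod L))) * h (a, (n : ZMod L)) := by
    induction n with
    | zero => simp
    | succ n ih =>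
      have hp := hflat (a, (n : ZMod L))
      simp only [Prod.mk_add_mk, add_zero] at hp
      rw [Finset.prod_range_succ, Finset.prod_range_succ, ← mul_assoc, ih, mul_assoc, hp,
        Nat.cast_succ, mul_assoc]
  have loop_nat (m : ℕ) : ∏ i ∈ Finset.range L, v ((m : ZMod L), (i : ZMod L)) = 1 := by
    induction m with
    | zero => simpa using hv
    | succ m ih =>
      have ht := transport m L
      rw [ih, ZMod.natCast_self, one_mul] at ht
      rw [Nat.cast_succ]
      exact mul_eq_left.mp ht
  have loop (a : ZMod L) : ∏ i ∈ Finset.range L, v (a, (i : ZMod L)) = 1 := by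
    simpa using loop_nat a.val
  refine ⟨fun x => (∏ i ∈ Finset.range x.1.val, h ((i : ZMod L), 0)) *
    ∏ i ∈ Finset.range x.2.val, v (x.1, (i : ZMod L)), ?_, ?_⟩
  · rintro ⟨a, b⟩
    have ht := transport a b.val
    rw [ZMod.natCast_zmod_val] at ht
    simp only [Prod.mk_add_mk, add_zero]
    rw [ZMod.prod_range_val_add_one (fun c => h (c, 0)) hh, mul_assoc, ht, mul_assoc]
  · rintro ⟨a, b⟩
    simp only [Prod.mk_add_mk, add_zero]
    rw [ZMod.prod_range_val_add_one (fun c => v (a, c)) (loop a), mul_assoc]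


/-- **Gauge-equivalent configurations differ by a gauge transformation.**
`Γ_L = (ℤ/Lℤ)²` is encoded as `ZMod L × ZMod L`; a bond field is a function
`σ : (ZMod L × ZMod L) → Fin 2 → ℤˣ`, where direction `0 : Fin 2` stands for `μ = 1`
(unit vector `e₁ = (1,0)`) and `1 : Fin 2` for `μ = 2` (unit vector `e₂ = (0,1)`). -/
theorem gauge_equivalent_iff_same_fluxes (L : ℕ) (hL : 1 ≤ L)
    (σ σ' : ZMod L × ZMod L → Fin 2 → ℤˣ)
    -- same plaquette flux at every x
    (hplaq : ∀ x : ZMod L × ZMod L,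
      σ x 0 * σ (x + (1, 0)) 1 * σ (x + (0, 1)) 0 * σ x 1 =
        σ' x 0 * σ' (x + (1, 0)) 1 * σ' (x + (0, 1)) 0 * σ' x 1)
    -- same horizontal loop product
    (hH : ∏ n ∈ Finset.range L, σ ((n : ZMod L), 0) 0 =
        ∏ n ∈ Finset.range L, σ' ((n : ZMod L), 0) 0)
    -- same vertical loop product
    (hV : ∏ n ∈ Finset.range L, σ (0, (n : ZMod L)) 1 =
        ∏ n ∈ Finset.range L, σ' (0, (n : ZMod L)) 1) :
    ∃ φ : ZMod L × ZMod L → ℤˣ,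
      (∀ x : ZMod L × ZMod L, σ' x 0 = φ x * σ x 0 * φ (x + (1, 0))) ∧
      (∀ x : ZMod L × ZMod L, σ' x 1 = φ x * σ x 1 * φ (x + (0, 1))) := by
  have : NeZero L := ⟨by omega⟩
  have solve (s s' p q : ℤˣ) (h : q = p * (s * s')) : s' = p * s * q := by
    subst h
    rcases Int.units_eq_one_or s with rfl | rfl <;> rcases Int.units_eq_one_or p with rfl | rfl <;>
      simp
  have hflat (a b c d a' b' c' d' : ℤˣ) (h : a * b * c * d = a' * b' * c' * d') :
      a * a' * (b * b') = d * d' * (c * c') := by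
    have hone : (a * a' * (b * b')) * (d * d' * (c * c')) = 1 := by
      calc _ = (a * b * c * d) * (a' * b' * c' * d') := by ac_rfl
        _ = 1 := by rw [h, Int.units_mul_self]
    rwa [mul_eq_one_iff_eq_inv, Int.units_inv_eq_self] at hone
  obtain ⟨φ, hφ₁, hφ₂⟩ := exists_potential_of_flat
    (fun x => σ x 0 * σ' x 0) (fun x => σ x 1 * σ' x 1)
    (fun x => hflat _ _ _ _ _ _ _ _ (hplaq x))
    (by rw [Finset.prod_mul_distrib, hH, Int.units_mul_self])
    (by rw [Finset.prod_mul_distrib, hV, Int.units_mul_self])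
  exact ⟨φ, fun x => solve _ _ _ _ (hφ₁ x), fun x => solve _ _ _ _ (hφ₂ x)⟩
end

section
/- For every t > 0 and k = (k₁,k₂) ∈ ℝ², the 8×8 complex matrix h(k) := −t·M(k) (with M(k) as defined in the context) has characteristic polynomial det(λ·I − h(k)) = (λ² − E₁(k))²·(λ² − E₂(k))², where E₁(k) := 4t²·(1 + (1/2)·√(1 + cos²(2k₁) + cos²(2k₂))) and E₂(k) := 4t²·(1 − (1/2)·√(1 + cos²(2k₁) + cos²(2k₂))). In particular, each of the four values ±√(E₁(k)), ±√(E₂(k)) is an eigenvalue of h(k) of multiplicity two. -/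
open Matrix Polynomial

/-- If an involution `V` anticommutes with `A`, then `det (y - A) ^ 2 = det (y ^ 2 - A ^ 2)`. -/
theorem det_scalar_sub_sq_of_anticommute {n S : Type*} [Fintype n] [DecidableEq n] [CommRing S]
    (A V : Matrix n n S) (hV : V * V = 1) (hA : V * A = -(A * V)) (y : S) :
    (scalar n y - A).det ^ 2 = (scalar n (y ^ 2) - A * A).det := by
  have hcomm : V * scalar n y = scalar n y * V :=
    (scalar_commute y (fun _ => Commute.all _ _) V).symm.eq
  have hconj : V * (scalar n y - A) * V = scalar n y + A := by
    rw [mul_sub, hA, hcomm, sub_neg_eq_add, ← add_mul, mul_assoc, hV, mul_one]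
  have hdet : (scalar n y + A).det = (scalar n y - A).det := by
    have hVdet : V.det * V.det = 1 := by rw [← det_mul, hV, det_one]
    rw [← hconj, det_mul, det_mul]
    linear_combination (scalar n y - A).det * hVdet
  have hcommA : scalar n y * A = A * scalar n y :=
    (scalar_commute y (fun _ => Commute.all _ _) A).eq
  calc (scalar n y - A).det ^ 2 = ((scalar n y - A) * (scalar n y + A)).det := by
        rw [det_mul, hdet, sq]
    _ = _ := by
        rw [sub_mul, mul_add, mul_add, hcommA, map_pow, sq]
        congr 1
        abel

theorem Polynomial.Monic.eq_of_sq_eq_sq {R : Type*} [CommRing R] [IsDomain R] [CharZero R]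
    {p q : R[X]} (hp : p.Monic) (hq : q.Monic) (h : p ^ 2 = q ^ 2) : p = q := by
  rcases sq_eq_sq_iff_eq_or_eq_neg.mp h with h | h
  · exact h
  · have h1 := congrArg Polynomial.leadingCoeff h
    rw [leadingCoeff_neg, hp.leadingCoeff, hq.leadingCoeff] at h1
    exact absurd h1 (by norm_num)

/-- A matrix `A` with a chiral symmetry `U`, whose square is a scalar plus a matrix `N` of scalar
square with a chiral symmetry `V`, has its characteristic polynomial determined by the scalars. -/
theorem charpoly_of_anticommute_of_sq {R : Type*} [CommRing R] [IsDomain R] [CharZero R]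
    {n : Type*} [Fintype n] [DecidableEq n] {m : ℕ} (hn : Fintype.card n = 4 * m)
    (A N U V : Matrix n n R) (a s : R) (hU : U * U = 1) (hUA : U * A = -(A * U))
    (hV : V * V = 1) (hVN : V * N = -(N * V)) (hA : A * A = scalar n a + N)
    (hN : N * N = scalar n s) :
    A.charpoly = ((X ^ 2 - C a) ^ 2 - C s) ^ m := by
  have lift_one {W : Matrix n n R} (h : W * W = 1) : W.map C * W.map C = 1 := by
    rw [← Matrix.map_mul, h, Matrix.map_one _ C_0 C_1]
  have lift_anti {W B : Matrix n n R} (h : W * B = -(B * W)) :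
      W.map C * B.map C = -(B.map C * W.map C) := by
    rw [← Matrix.map_mul, ← Matrix.map_mul, h]
    exact Matrix.map_neg _ (fun _ => C_neg) _
  have hscalar (r : R) : (scalar n r).map C = scalar n (C r) := by
    simp [scalar_apply, diagonal_map]
  have h1 := det_scalar_sub_sq_of_anticommute _ _ (lift_one hU) (lift_anti hUA) (X : R[X])
  have h2 := det_scalar_sub_sq_of_anticommute _ _ (lift_one hV) (lift_anti hVN)
    (X ^ 2 - C a : R[X])
  have h3 : scalar n (X ^ 2 : R[X]) - A.map C * A.map C
      = scalar n (X ^ 2 - C a) - N.map C := by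
    rw [← Matrix.map_mul, hA, Matrix.map_add _ (fun _ _ => C_add), hscalar, map_sub]
    abel
  rw [h3] at h1
  rw [← h1, ← Matrix.map_mul, hN, hscalar, ← map_sub, scalar_apply (_ - _), det_diagonal,
    Finset.prod_const, Finset.card_univ, hn] at h2
  have hmonic : ((X ^ 2 - C a) ^ 2 - C s : R[X]).Monic := by
    have : ((X ^ 2 - C a) ^ 2 - C s : R[X])
        = X ^ 4 + (C (-2 * a) * X ^ 2 + C (a ^ 2 - s)) := by
      simp only [C_mul, C_sub, C_pow, C_neg, C_ofNat]
      ring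
    rw [this]
    exact monic_X_pow_add (by compute_degree!)
  have hchar := A.charpoly_monic
  refine hchar.eq_of_sq_eq_sq (hmonic.pow m) ?_
  refine (hchar.pow 2).eq_of_sq_eq_sq ((hmonic.pow m).pow 2) ?_
  rw [charpoly, charmatrix]
  refine h2.trans ?_
  rw [← pow_mul, ← pow_mul]
  congr 1
  ring

theorem rootMultiplicity_eq_of_eq_mul {R : Type*} [CommRing R] [IsDomain R] {p q : R[X]} {μ : R}
    {k : ℕ} (hp : p = q * (X - C μ) ^ k) (hq : q.eval μ ≠ 0) : p.rootMultiplicity μ = k := by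
  have hq0 : q ≠ 0 := by
    rintro rfl
    simp at hq
  rw [hp, rootMultiplicity_mul_X_sub_C_pow hq0, rootMultiplicity_eq_zero hq, zero_add]

/-- The Bloch matrix, with `z`, `z'` for `exp (± 4 i k₁)` and `w`, `w'` for `exp (± 2 i k₂)`. -/
def blochMatrix {R : Type*} [CommRing R] (z z' w w' : R) : Matrix (Fin 8) (Fin 8) R :=
  !![0, 1, 0, z', 1 + w', 0, 0, 0;
     1, 0, 1, 0, 0, -1 + w', 0, 0;
     0, 1, 0, 1, 0, 0, -1 + w', 0;
     z, 0, 1, 0, 0, 0, 0, 1 + w';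
     1 + w, 0, 0, 0, 0, -1, 0, -z';
     0, -1 + w, 0, 0, -1, 0, -1, 0;
     0, 0, -1 + w, 0, 0, -1, 0, -1;
     0, 0, 0, 1 + w, -z, 0, -1, 0]

/-- The traceless part of the square of `blochMatrix`. -/
def blochSquare {R : Type*} [CommRing R] (z z' w w' : R) : Matrix (Fin 8) (Fin 8) R :=
  !![w + w', 0, 1 + z', 0, 0, -2, 0, 0;
     0, -(w + w'), 0, 1 + z', 2, 0, 0, 0;
     1 + z, 0, -(w + w'), 0, 0, 0, 0, 2;
     0, 1 + z, 0, w + w', 0, 0, -2, 0;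
     0, 2, 0, 0, w + w', 0, 1 + z', 0;
     -2, 0, 0, 0, 0, -(w + w'), 0, 1 + z';
     0, 0, 0, -2, 1 + z, 0, -(w + w'), 0;
     0, 0, 2, 0, 0, 1 + z, 0, w + w']

/-- The sublattice (chiral) symmetry of `blochMatrix`. -/
def sublatticeSign (R : Type*) [CommRing R] : Matrix (Fin 8) (Fin 8) R :=
  diagonal ![1, -1, 1, -1, -1, 1, -1, 1]

/-- A signed permutation anticommuting with `blochSquare`. -/
def signedSwap (R : Type*) [CommRing R] : Matrix (Fin 8) (Fin 8) R :=
  !![0, -1, 0, 0, 0, 0, 0, 0;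
     -1, 0, 0, 0, 0, 0, 0, 0;
     0, 0, 0, 1, 0, 0, 0, 0;
     0, 0, 1, 0, 0, 0, 0, 0;
     0, 0, 0, 0, 0, -1, 0, 0;
     0, 0, 0, 0, -1, 0, 0, 0;
     0, 0, 0, 0, 0, 0, 0, 1;
     0, 0, 0, 0, 0, 0, 1, 0]

section

variable {R : Type*} [CommRing R] (z z' w w' : R)

theorem sublatticeSign_mul_self : sublatticeSign R * sublatticeSign R = 1 := by
  rw [sublatticeSign, diagonal_mul_diagonal, ← diagonal_one]
  congr 1
  ext i
  fin_cases i <;> simp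

theorem signedSwap_mul_self : signedSwap R * signedSwap R = 1 := by
  ext i j
  fin_cases i <;> fin_cases j <;> simp [signedSwap, mul_apply, Fin.sum_univ_eight]

theorem sublatticeSign_mul_blochMatrix :
    sublatticeSign R * blochMatrix z z' w w' = -(blochMatrix z z' w w' * sublatticeSign R) := by
  ext i j
  rw [neg_apply, sublatticeSign, diagonal_mul, mul_diagonal]
  fin_cases i <;> fin_cases j <;> simp [blochMatrix]

set_option maxHeartbeats 1000000 in
theorem signedSwap_mul_blochSquare :
    signedSwap R * blochSquare z z' w w' = -(blochSquare z z' w w' * signedSwap R) := by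
  ext i j
  fin_cases i <;> fin_cases j <;>
    simp [signedSwap, blochSquare, mul_apply, Fin.sum_univ_eight]

variable {z z' w w'}

set_option maxHeartbeats 1000000 in
theorem blochMatrix_mul_self (hz : z * z' = 1) (hw : w * w' = 1) :
    blochMatrix z z' w w' * blochMatrix z z' w w'
      = scalar (Fin 8) 4 + blochSquare z z' w w' := by
  ext i j
  fin_cases i <;> fin_cases j <;>
    simp [blochMatrix, blochSquare, mul_apply, Fin.sum_univ_eight] <;> grind

theorem blochSquare_mul_self (hz : z * z' = 1) :
    blochSquare z z' w w' * blochSquare z z' w w'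
      = scalar (Fin 8) (6 + z + z' + (w + w') ^ 2) := by
  ext i j
  fin_cases i <;> fin_cases j <;>
    simp [blochSquare, mul_apply, Fin.sum_univ_eight] <;> grind

theorem charpoly_smul_blochMatrix [IsDomain R] [CharZero R] (hz : z * z' = 1) (hw : w * w' = 1)
    (r : R) :
    (r • blochMatrix z z' w w').charpoly
      = ((X ^ 2 - C (4 * r ^ 2)) ^ 2 - C (r ^ 4 * (6 + z + z' + (w + w') ^ 2))) ^ 2 := by
  refine charpoly_of_anticommute_of_sq (by simp) _ (r ^ 2 • blochSquare z z' w w')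
    (sublatticeSign R) (signedSwap R) _ _ sublatticeSign_mul_self ?_ signedSwap_mul_self ?_ ?_ ?_
  · rw [Matrix.mul_smul, Matrix.smul_mul, sublatticeSign_mul_blochMatrix, smul_neg]
  · rw [Matrix.mul_smul, Matrix.smul_mul, signedSwap_mul_blochSquare, smul_neg]
  · rw [Matrix.mul_smul, Matrix.smul_mul, blochMatrix_mul_self hz hw, smul_smul, smul_add, sq]
    congr 1
    ext i j
    simp only [scalar_apply, Matrix.smul_apply, diagonal_apply, smul_eq_mul]
    split_ifs <;> ring
  · rw [Matrix.mul_smul, Matrix.smul_mul, blochSquare_mul_self hz, smul_smul]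
    ext i j
    simp only [scalar_apply, Matrix.smul_apply, diagonal_apply, smul_eq_mul]
    split_ifs <;> ring

end

theorem Complex.exp_add_exp_neg_two_mul (k : ℝ) :
    Complex.exp (2 * Complex.I * k) + Complex.exp (-(2 * Complex.I * k))
      = 2 * (Real.cos (2 * k) : ℂ) := by
  rw [Complex.ofReal_cos, Complex.two_cos]
  push_cast
  congr 2 <;> ring

/-- **Characteristic polynomial of the Bloch Hamiltonian of the staggered
(chessboard) flux configuration.**  With the 8×8 matrix `M(k)` indexed by
`(a,b,c,d,A,B,C,D) = (0,…,7)` and `h(k) = −t·M(k)`, the characteristic polynomial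
is `(λ² − E₁(k))²(λ² − E₂(k))²`, and each of `±√E₁(k)`, `±√E₂(k)` is an eigenvalue
of `h(k)` of multiplicity two. -/
theorem staggered_flux_charpoly (t k₁ k₂ : ℝ) (ht : 0 < t) :
    let M : Matrix (Fin 8) (Fin 8) ℂ :=
      !![0, 1, 0, Complex.exp (-(4 * Complex.I * k₁)),
            1 + Complex.exp (-(2 * Complex.I * k₂)), 0, 0, 0;
         1, 0, 1, 0, 0, -1 + Complex.exp (-(2 * Complex.I * k₂)), 0, 0;
         0, 1, 0, 1, 0, 0, -1 + Complex.exp (-(2 * Complex.I * k₂)), 0;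
         Complex.exp (4 * Complex.I * k₁), 0, 1, 0, 0, 0, 0,
            1 + Complex.exp (-(2 * Complex.I * k₂));
         1 + Complex.exp (2 * Complex.I * k₂), 0, 0, 0, 0, -1, 0,
            -Complex.exp (-(4 * Complex.I * k₁));
         0, -1 + Complex.exp (2 * Complex.I * k₂), 0, 0, -1, 0, -1, 0;
         0, 0, -1 + Complex.exp (2 * Complex.I * k₂), 0, 0, -1, 0, -1;
         0, 0, 0, 1 + Complex.exp (2 * Complex.I * k₂),
            -Complex.exp (4 * Complex.I * k₁), 0, -1, 0]
    let h : Matrix (Fin 8) (Fin 8) ℂ := (-(t : ℂ)) • M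
    let E₁ : ℝ :=
      4 * t ^ 2 * (1 + Real.sqrt (1 + Real.cos (2 * k₁) ^ 2 + Real.cos (2 * k₂) ^ 2) / 2)
    let E₂ : ℝ :=
      4 * t ^ 2 * (1 - Real.sqrt (1 + Real.cos (2 * k₁) ^ 2 + Real.cos (2 * k₂) ^ 2) / 2)
    h.charpoly =
        (Polynomial.X ^ 2 - Polynomial.C ((E₁ : ℂ))) ^ 2 *
          (Polynomial.X ^ 2 - Polynomial.C ((E₂ : ℂ))) ^ 2 ∧
      ∀ μ : ℂ,
        (μ = (Real.sqrt E₁ : ℂ) ∨ μ = -(Real.sqrt E₁ : ℂ) ∨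
          μ = (Real.sqrt E₂ : ℂ) ∨ μ = -(Real.sqrt E₂ : ℂ)) →
        Polynomial.rootMultiplicity μ h.charpoly = 2 := by
  intro M h E₁ E₂
  set c := Real.cos (2 * k₁)
  set d := Real.cos (2 * k₂)
  set ρ := Real.sqrt (1 + c ^ 2 + d ^ 2)
  have hz : Complex.exp (4 * Complex.I * k₁) * Complex.exp (-(4 * Complex.I * k₁)) = 1 := by
    rw [← Complex.exp_add, add_neg_cancel, Complex.exp_zero]
  have hw : Complex.exp (2 * Complex.I * k₂) * Complex.exp (-(2 * Complex.I * k₂)) = 1 := by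
    rw [← Complex.exp_add, add_neg_cancel, Complex.exp_zero]
  have hρ : ρ ^ 2 = 1 + c ^ 2 + d ^ 2 := Real.sq_sqrt (by positivity)
  have hρ1 : 0 < ρ := Real.sqrt_pos.mpr (by positivity)
  have hρ2 : ρ < 2 := by
    have hc : c ^ 2 ≤ 1 := Real.cos_sq_le_one _
    have hd : d ^ 2 ≤ 1 := Real.cos_sq_le_one _
    nlinarith
  have hE₁ : 0 < E₁ := by positivity
  have hE₂ : 0 < E₂ := mul_pos (by positivity) (by linarith)
  have hE : E₂ ≠ E₁ := by
    refine (mul_lt_mul_of_pos_left ?_ (by positivity)).ne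
    linarith
  have hs : 6 + Complex.exp (4 * Complex.I * k₁) + Complex.exp (-(4 * Complex.I * k₁))
      + (Complex.exp (2 * Complex.I * k₂) + Complex.exp (-(2 * Complex.I * k₂))) ^ 2
      = 4 * (ρ : ℂ) ^ 2 := by
    have hρ' : (ρ : ℂ) ^ 2 = 1 + (c : ℂ) ^ 2 + (d : ℂ) ^ 2 := by exact_mod_cast hρ
    have h4 : Complex.exp (4 * Complex.I * k₁) = Complex.exp (2 * Complex.I * k₁) ^ 2 := by
      rw [← Complex.exp_nat_mul]
      congr 1
      push_cast
      ring
    have h4' : Complex.exp (-(4 * Complex.I * k₁)) = Complex.exp (-(2 * Complex.I * k₁)) ^ 2 := by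
      rw [← Complex.exp_nat_mul]
      congr 1
      push_cast
      ring
    have h1 : Complex.exp (2 * Complex.I * k₁) * Complex.exp (-(2 * Complex.I * k₁)) = 1 := by
      rw [← Complex.exp_add, add_neg_cancel, Complex.exp_zero]
    have hc := Complex.exp_add_exp_neg_two_mul k₁
    rw [hρ', h4, h4', Complex.exp_add_exp_neg_two_mul k₂]
    linear_combination (Complex.exp (2 * Complex.I * k₁) + Complex.exp (-(2 * Complex.I * k₁))
      + 2 * c) * hc - 2 * h1
  have hcharpoly : h.charpoly = (X ^ 2 - C (E₁ : ℂ)) ^ 2 * (X ^ 2 - C (E₂ : ℂ)) ^ 2 := by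
    refine (charpoly_smul_blochMatrix hz hw (-(t : ℂ))).trans ?_
    rw [hs, ← mul_pow]
    simp only [E₁, E₂]
    push_cast
    congr 1
    have hadd : C (4 * (-(t : ℂ)) ^ 2) = C (4 * (t : ℂ) ^ 2) := by rw [neg_sq]
    have hprod : C ((-(t : ℂ)) ^ 4 * (4 * (ρ : ℂ) ^ 2)) = C (2 * (t : ℂ) ^ 2 * ρ) ^ 2 := by
      rw [← C_pow]
      congr 1
      ring
    have h₁ : (4 * (t : ℂ) ^ 2 * (1 + ρ / 2)) = 4 * (t : ℂ) ^ 2 + 2 * (t : ℂ) ^ 2 * ρ := by ring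
    have h₂ : (4 * (t : ℂ) ^ 2 * (1 - ρ / 2)) = 4 * (t : ℂ) ^ 2 - 2 * (t : ℂ) ^ 2 * ρ := by ring
    rw [hadd, hprod, h₁, h₂, C_add, C_sub]
    ring
  refine ⟨hcharpoly, ?_⟩
  have mult {E F : ℝ} (hE : 0 < E) (hFE : F ≠ E) {μ : ℂ} (hμ : μ ^ 2 = E) :
      rootMultiplicity μ ((X ^ 2 - C (E : ℂ)) ^ 2 * (X ^ 2 - C (F : ℂ)) ^ 2) = 2 := by
    have hμ0 : μ ≠ 0 := by
      rintro rfl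
      exact hE.ne (by exact_mod_cast (by simpa using hμ : (0 : ℂ) = E))
    refine rootMultiplicity_eq_of_eq_mul (q := (X + C μ) ^ 2 * (X ^ 2 - C (F : ℂ)) ^ 2) ?_ ?_
    · rw [← hμ, C_pow]
      ring
    · have hEF : (E : ℂ) - F ≠ 0 := sub_ne_zero.mpr (by exact_mod_cast hFE.symm)
      have h2 : μ + μ ≠ 0 := by simpa [← two_mul] using hμ0
      simp [hμ, hEF, h2]
  have sq_sqrt {E : ℝ} (hE : 0 < E) : (Real.sqrt E : ℂ) ^ 2 = E := by
    exact_mod_cast Real.sq_sqrt hE.le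
  rw [hcharpoly]
  rintro μ (rfl | rfl | rfl | rfl)
  · exact mult hE₁ hE (sq_sqrt hE₁)
  · exact mult hE₁ hE (by rw [neg_sq, sq_sqrt hE₁])
  · rw [mul_comm]
    exact mult hE₂ hE.symm (sq_sqrt hE₂)
  · rw [mul_comm]
    exact mult hE₂ hE.symm (by rw [neg_sq, sq_sqrt hE₂])
end

section
/- Let ℓ ≥ 1, L = 4ℓ, t > 0 and β > 0. For (a,b) ∈ {−1,1}² define P(a,b) := ∏_{k ∈ B_L(a,b)} (1 − e^{−β·e₊(k)})·(1 − e^{−β·e₋(k)}). Then P(1,1) = 0, and P(a,b) > 0 for every (a,b) ∈ {−1,1}² with (a,b) ≠ (1,1). -/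
/-- The product of `2m` negative reals is positive. -/
lemma prod_range_two_mul_pos_of_neg {f : ℕ → ℝ} (hf : ∀ n, f n < 0) (m : ℕ) :
    0 < ∏ n ∈ Finset.range (2 * m), f n := by
  have h : 0 < ∏ n ∈ Finset.range (2 * m), -f n :=
    Finset.prod_pos fun n _ => neg_pos.mpr (hf n)
  simpa [Finset.prod_neg] using h

lemma one_sub_exp_mul_one_sub_exp_neg {β e : ℝ} (hβ : 0 < β) (he : e < 0) :
    (1 - Real.exp (-β * -e)) * (1 - Real.exp (-β * e)) < 0 := by
  have h : β * e < 0 := mul_neg_of_pos_of_neg hβ he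
  apply mul_neg_of_pos_of_neg
  · exact sub_pos.mpr (Real.exp_lt_one_iff.mpr (by linarith))
  · exact sub_neg.mpr (Real.one_lt_exp_iff.mpr (by linarith))

/-- The half-integer momenta never reach a zero of `1 + cos (2k)`. -/
lemma neg_one_lt_cos_two_mul_shifted_momentum {ℓ : ℕ} (hℓ : 1 ≤ ℓ) (n : ℕ) :
    -1 < Real.cos (2 * (2 * Real.pi / ((4 * ℓ : ℕ) : ℝ) * ((n : ℝ) - (-1 - 1) / 4))) := by
  refine lt_of_le_of_ne (Real.neg_one_le_cos _) fun h => ?_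
  obtain ⟨k, hk⟩ := Real.cos_eq_neg_one_iff.mp h.symm
  have hℓ' : (ℓ : ℝ) ≠ 0 := by positivity
  have hπ := Real.pi_ne_zero
  have h2 : (2 * ℓ * (1 + 2 * k) : ℝ) = 2 * n + 1 := by
    push_cast at hk
    field_simp at hk
    linarith
  have h3 : 2 * ((ℓ : ℤ) * (1 + 2 * k)) = 2 * n + 1 := by
    rw [← mul_assoc]
    exact_mod_cast h2
  omega

lemma cos_two_mul_momentum_eq_neg_one {ℓ : ℕ} (hℓ : 1 ≤ ℓ) :
    Real.cos (2 * (2 * Real.pi / ((4 * ℓ : ℕ) : ℝ) * ((ℓ : ℝ) - (1 - 1) / 4))) = -1 := by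
  have hℓ' : (ℓ : ℝ) ≠ 0 := by positivity
  rw [← Real.cos_pi]
  congr 1
  push_cast
  field_simp
  ring

/-- **Odd partition functions of the four π-flux phases.**  With `L = 4ℓ`,
`e₋(k) = −2t√(1 + cos(2k₁)/2 + cos(2k₂)/2)`, `e₊ = −e₋`, and the Brillouin zone
`B_L(a,b) = {((2π/L)(n₁ − (a−1)/4), (2π/L)(n₂ − (b−1)/4))}`, the odd partition
function `P(a,b) = ∏_{k ∈ B_L(a,b)} (1 − e^{−β e₊(k)})(1 − e^{−β e₋(k)})`
vanishes for `(a,b) = (1,1)` and is strictly positive otherwise. -/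
theorem pi_flux_odd_partition_functions (ℓ L : ℕ) (hℓ : 1 ≤ ℓ) (hL : L = 4 * ℓ)
    (t β : ℝ) (ht : 0 < t) (hβ : 0 < β) :
    let eminus : ℝ → ℝ → ℝ := fun x y =>
      -2 * t * Real.sqrt (1 + Real.cos (2 * x) / 2 + Real.cos (2 * y) / 2)
    let P : ℝ → ℝ → ℝ := fun a b =>
      ∏ n₁ ∈ Finset.range L, ∏ n₂ ∈ Finset.range (L / 2),
        ((1 - Real.exp (-β * (-(eminus (2 * Real.pi / L * ((n₁ : ℝ) - (a - 1) / 4))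
              (2 * Real.pi / L * ((n₂ : ℝ) - (b - 1) / 4)))))) *
         (1 - Real.exp (-β * eminus (2 * Real.pi / L * ((n₁ : ℝ) - (a - 1) / 4))
              (2 * Real.pi / L * ((n₂ : ℝ) - (b - 1) / 4)))))
    P 1 1 = 0 ∧
      ∀ a b : ℝ, (a = 1 ∨ a = -1) → (b = 1 ∨ b = -1) → ¬(a = 1 ∧ b = 1) →
        0 < P a b := by
  intro eminus P
  subst hL
  have hhalf : 4 * ℓ / 2 = 2 * ℓ := by omega
  constructor
  · refine Finset.prod_eq_zero (i := ℓ) (Finset.mem_range.mpr (by omega))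
      (Finset.prod_eq_zero (i := ℓ) (Finset.mem_range.mpr (by omega)) ?_)
    simp only [eminus, cos_two_mul_momentum_eq_neg_one hℓ]
    norm_num
  · intro a b ha hb hab
    refine Finset.prod_pos fun n₁ _ => ?_
    rw [hhalf]
    refine prod_range_two_mul_pos_of_neg (fun n₂ => ?_) ℓ
    refine one_sub_exp_mul_one_sub_exp_neg hβ ?_
    refine mul_neg_of_neg_of_pos (by linarith) (Real.sqrt_pos.mpr ?_)
    have h : a = -1 ∨ b = -1 := by tauto
    rcases h with rfl | rfl
    · linarith [neg_one_lt_cos_two_mul_shifted_momentum hℓ n₁, Real.neg_one_le_cos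
        (2 * (2 * Real.pi / ((4 * ℓ : ℕ) : ℝ) * ((n₂ : ℝ) - (b - 1) / 4)))]
    · linarith [neg_one_lt_cos_two_mul_shifted_momentum hℓ n₂, Real.neg_one_le_cos
        (2 * (2 * Real.pi / ((4 * ℓ : ℕ) : ℝ) * ((n₁ : ℝ) - (a - 1) / 4)))]
end

section
/- For every α with 0 < α < 1/3 there exists a constant C_α > 0 such that for every integer n ≥ 1 and every (a,b) ∈ {−1,1}²: | Σ_{n₁=0}^{2n−1} Σ_{n₂=0}^{2n−1} [ f( πn₁/n − π(a−1)/(4n), πn₂/n − π(b−1)/(4n) ) − f( πn₁/n, πn₂/n ) ] | ≤ C_α · n^{3α−1}, where f(x,y) := −√(1 + (1/2)·cos x + (1/2)·cos y). -/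
/-- Up to sign, the dispersion relation of the π-flux phase. -/
noncomputable def dispersion (x y : ℝ) : ℝ :=
  Real.sqrt (1 + Real.cos x / 2 + Real.cos y / 2)

lemma dispersion_comm (x y : ℝ) : dispersion x y = dispersion y x := by
  unfold dispersion
  ring_nf

lemma dispersion_periodic (y : ℝ) :
    Function.Periodic (fun x => dispersion x y) (2 * Real.pi) := fun x => by
  simp only [dispersion, Real.cos_add_two_pi]

/-! ### Finite differences -/

lemma abs_difference_le {f f' : ℝ → ℝ} {a δ M : ℝ} (hδ : 0 ≤ δ)
    (hf : ∀ t ∈ Set.Icc a (a + δ), HasDerivAt f (f' t) t)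
    (hM : ∀ t ∈ Set.Icc a (a + δ), |f' t| ≤ M) :
    |f (a + δ) - f a| ≤ M * δ := by
  have h := (convex_Icc a (a + δ)).norm_image_sub_le_of_norm_hasDerivWithin_le
    (fun t ht => (hf t ht).hasDerivWithinAt) hM
    (Set.left_mem_Icc.2 (by linarith)) (Set.right_mem_Icc.2 (by linarith))
  simpa [abs_of_nonneg hδ] using h

lemma abs_second_difference_le {f f₁ f₂ : ℝ → ℝ} {a δ M : ℝ} (hδ : 0 ≤ δ)
    (hf : ∀ t ∈ Set.Icc a (a + 2 * δ), HasDerivAt f (f₁ t) t)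
    (hf₁ : ∀ t ∈ Set.Icc a (a + 2 * δ), HasDerivAt f₁ (f₂ t) t)
    (hM : ∀ t ∈ Set.Icc a (a + 2 * δ), |f₂ t| ≤ M) :
    |f (a + 2 * δ) - 2 * f (a + δ) + f a| ≤ M * δ ^ 2 := by
  have h := abs_difference_le (f := fun t => f (t + δ) - f t)
    (f' := fun t => f₁ (t + δ) - f₁ t) (a := a) (M := M * δ) hδ
    (fun t ht => ((hf (t + δ) ⟨by linarith [ht.1], by linarith [ht.2]⟩).comp_add_const t δ).sub
      (hf t ⟨ht.1, by linarith [ht.2]⟩))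
    (fun t ht => abs_difference_le hδ
      (fun s hs => hf₁ s ⟨by linarith [ht.1, hs.1], by linarith [ht.2, hs.2]⟩)
      (fun s hs => hM s ⟨by linarith [ht.1, hs.1], by linarith [ht.2, hs.2]⟩))
  convert h using 1
  · ring_nf
  · ring

lemma abs_third_difference_le {f f₁ f₂ f₃ : ℝ → ℝ} {a δ M : ℝ} (hδ : 0 ≤ δ)
    (hf : ∀ t ∈ Set.Icc a (a + 3 * δ), HasDerivAt f (f₁ t) t)
    (hf₁ : ∀ t ∈ Set.Icc a (a + 3 * δ), HasDerivAt f₁ (f₂ t) t)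
    (hf₂ : ∀ t ∈ Set.Icc a (a + 3 * δ), HasDerivAt f₂ (f₃ t) t)
    (hM : ∀ t ∈ Set.Icc a (a + 3 * δ), |f₃ t| ≤ M) :
    |f (a + 3 * δ) - 3 * f (a + 2 * δ) + 3 * f (a + δ) - f a| ≤ M * δ ^ 3 := by
  have h := abs_second_difference_le (f := fun t => f (t + δ) - f t)
    (f₁ := fun t => f₁ (t + δ) - f₁ t) (f₂ := fun t => f₂ (t + δ) - f₂ t)
    (a := a) (M := M * δ) hδ
    (fun t ht => ((hf (t + δ) ⟨by linarith [ht.1], by linarith [ht.2]⟩).comp_add_const t δ).sub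
      (hf t ⟨ht.1, by linarith [ht.2]⟩))
    (fun t ht => ((hf₁ (t + δ) ⟨by linarith [ht.1], by linarith [ht.2]⟩).comp_add_const t δ).sub
      (hf₁ t ⟨ht.1, by linarith [ht.2]⟩))
    (fun t ht => abs_difference_le hδ
      (fun s hs => hf₂ s ⟨by linarith [ht.1, hs.1], by linarith [ht.2, hs.2]⟩)
      (fun s hs => hM s ⟨by linarith [ht.1, hs.1], by linarith [ht.2, hs.2]⟩))
  convert h using 1
  · ring_nf
  · ring

lemma sum_range_add_one_eq {p : ℕ → ℝ} {m : ℕ} (h : p m = p 0) :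
    ∑ i ∈ Finset.range m, p (i + 1) = ∑ i ∈ Finset.range m, p i := by
  have h₁ := Finset.sum_range_succ p m
  have h₂ := Finset.sum_range_succ' p m
  linarith

lemma sum_third_difference {f : ℝ → ℝ} {δ : ℝ} {m : ℕ}
    (hf : Function.Periodic f (2 * m * δ)) :
    ∑ i ∈ Finset.range m, (f (2 * i * δ + 3 * δ) - 3 * f (2 * i * δ + 2 * δ)
      + 3 * f (2 * i * δ + δ) - f (2 * i * δ)) =
    4 * ∑ i ∈ Finset.range m, (f (2 * i * δ + δ) - f (2 * i * δ)) := by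
  have h₀ := sum_range_add_one_eq (p := fun i : ℕ => f (2 * i * δ)) (m := m)
    (by simpa using hf 0)
  have h₁ := sum_range_add_one_eq (p := fun i : ℕ => f (2 * i * δ + δ)) (m := m)
    (by simpa [add_comm] using hf δ)
  have e₀ : ∀ i : ℕ, f (2 * i * δ + 2 * δ) = f (2 * (i + 1 : ℕ) * δ) := fun i => by
    congr 1; push_cast; ring
  have e₁ : ∀ i : ℕ, f (2 * i * δ + 3 * δ) = f (2 * (i + 1 : ℕ) * δ + δ) := fun i => by
    congr 1; push_cast; ring
  simp only [e₀, e₁, Finset.sum_add_distrib, Finset.sum_sub_distrib, ← Finset.mul_sum]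
  linarith

/-! ### Derivatives of the dispersion -/

lemma abs_third_difference_dispersion_le {a y δ m : ℝ} (hδ : 0 ≤ δ) (hm : 0 < m)
    (hW : ∀ t ∈ Set.Icc a (a + 3 * δ), m ≤ 1 + Real.cos t / 2 + Real.cos y / 2) :
    |dispersion (a + 3 * δ) y - 3 * dispersion (a + 2 * δ) y
      + 3 * dispersion (a + δ) y - dispersion a y| ≤ 2 / m * δ ^ 3 := by
  set g : ℝ → ℝ := fun t => dispersion t y with hg
  have hpos : ∀ t ∈ Set.Icc a (a + 3 * δ), 0 < g t := fun t ht =>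
    Real.sqrt_pos.2 (hm.trans_le (hW t ht))
  have hsq : ∀ t ∈ Set.Icc a (a + 3 * δ), g t ^ 2 = 1 + Real.cos t / 2 + Real.cos y / 2 :=
    fun t ht => Real.sq_sqrt (hm.le.trans (hW t ht))
  have h₁ : ∀ t ∈ Set.Icc a (a + 3 * δ), HasDerivAt g (-Real.sin t / (4 * g t)) t := by
    intro t ht
    have hW' : HasDerivAt (fun t => 1 + Real.cos t / 2 + Real.cos y / 2) (-Real.sin t / 2) t :=
      (((Real.hasDerivAt_cos t).div_const 2).const_add 1).add_const _
    refine (hW'.sqrt (hm.trans_le (hW t ht)).ne').congr_deriv ?_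
    have := (hpos t ht).ne'
    change _ / (2 * g t) = _
    field_simp
    norm_num
  have h₂ : ∀ t ∈ Set.Icc a (a + 3 * δ), HasDerivAt (fun t => -Real.sin t / (4 * g t))
      (-Real.cos t / (4 * g t) - Real.sin t ^ 2 / (16 * g t ^ 3)) t := by
    intro t ht
    have h0 := (hpos t ht).ne'
    refine ((Real.hasDerivAt_sin t).neg.div ((h₁ t ht).const_mul 4)
      (by positivity)).congr_deriv ?_
    simp only [Pi.neg_apply]
    field_simp
    ring
  have h₃ : ∀ t ∈ Set.Icc a (a + 3 * δ), HasDerivAt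
      (fun t => -Real.cos t / (4 * g t) - Real.sin t ^ 2 / (16 * g t ^ 3))
      (Real.sin t / (4 * g t) - 3 * Real.sin t * Real.cos t / (16 * g t ^ 3)
        - 3 * Real.sin t ^ 3 / (64 * g t ^ 5)) t := by
    intro t ht
    have h0 := (hpos t ht).ne'
    refine (((Real.hasDerivAt_cos t).neg.div ((h₁ t ht).const_mul 4) (by positivity)).sub
      (((Real.hasDerivAt_sin t).pow 2).div (((h₁ t ht).pow 3).const_mul 16)
        (mul_ne_zero (by norm_num) (pow_ne_zero 3 h0)))).congr_deriv ?_
    simp only [Pi.neg_apply, Pi.pow_apply]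
    field_simp
    ring
  refine abs_third_difference_le hδ h₁ h₂ h₃ fun t ht => ?_
  have hp := hpos t ht
  have hs := hsq t ht
  have hmt := hW t ht
  rw [← hs] at hmt
  have hc := Real.cos_le_one t
  have hc' := Real.neg_one_le_cos t
  have hy := Real.cos_le_one y
  have hy' := Real.neg_one_le_cos y
  have hg2 : g t ^ 2 ≤ 2 := by rw [hs]; linarith
  have hsin : |Real.sin t| ≤ 2 * g t := by
    apply abs_le_of_sq_le_sq _ (by positivity)
    nlinarith [Real.sin_sq_add_cos_sq t]
  have hcos : |Real.cos t| ≤ 1 := Real.abs_cos_le_one t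
  have b₁ : |Real.sin t / (4 * g t)| ≤ 1 / g t ^ 2 := by
    rw [abs_div, abs_of_pos (show 0 < 4 * g t by positivity), div_le_div_iff₀ (by positivity)
      (by positivity)]
    nlinarith
  have b₂ : |3 * Real.sin t * Real.cos t / (16 * g t ^ 3)| ≤ 3 / 8 * (1 / g t ^ 2) := by
    have : |3 * Real.sin t * Real.cos t| ≤ 6 * g t := by
      rw [abs_mul, abs_mul, abs_of_pos (show (0 : ℝ) < 3 by norm_num)]
      nlinarith [abs_nonneg (Real.sin t), abs_nonneg (Real.cos t)]
    rw [abs_div, abs_of_pos (show 0 < 16 * g t ^ 3 by positivity), div_le_iff₀ (by positivity)]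
    refine this.trans (le_of_eq ?_)
    field_simp
    norm_num
  have b₃ : |3 * Real.sin t ^ 3 / (64 * g t ^ 5)| ≤ 3 / 8 * (1 / g t ^ 2) := by
    have : |3 * Real.sin t ^ 3| ≤ 3 * (2 * g t) ^ 3 := by
      rw [abs_mul, abs_pow, abs_of_pos (show (0 : ℝ) < 3 by norm_num)]
      gcongr
    rw [abs_div, abs_of_pos (show 0 < 64 * g t ^ 5 by positivity), div_le_iff₀ (by positivity)]
    refine this.trans (le_of_eq ?_)
    field_simp
    norm_num
  have hm2 : 1 / g t ^ 2 ≤ 1 / m := one_div_le_one_div_of_le hm hmt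
  have hm0 : 0 < 1 / m := by positivity
  have e : 2 / m = 2 * (1 / m) := by ring
  rw [e]
  rw [abs_le] at b₁ b₂ b₃ ⊢
  constructor <;> linarith

/-! ### Behaviour near the conical point -/

lemma sq_sub_pi_div_le_one_add_cos {x : ℝ} (hx : |x - Real.pi| ≤ 3 * Real.pi / 2) :
    (x - Real.pi) ^ 2 / 25 ≤ 1 + Real.cos x := by
  have hpi := Real.pi_pos
  have hpi' := Real.pi_lt_d2
  set u := x - Real.pi with hu
  have hcos : Real.cos x = -Real.cos u := by rw [hu, Real.cos_sub_pi, neg_neg]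
  rw [hcos]
  rcases le_total |u| Real.pi with h | h
  · have h' := Real.cos_le_one_sub_mul_cos_sq h
    have : u ^ 2 / 25 ≤ 2 / Real.pi ^ 2 * u ^ 2 := by
      rw [div_mul_eq_mul_div, div_le_div_iff₀ (by norm_num) (by positivity)]
      have hpi2 : Real.pi ^ 2 ≤ 50 := by nlinarith
      nlinarith [mul_le_mul_of_nonneg_left hpi2 (sq_nonneg u)]
    linarith
  · have hc : Real.cos u ≤ 0 := by
      rw [← Real.cos_abs]
      exact Real.cos_nonpos_of_pi_div_two_le_of_le (by linarith) (by linarith)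
    have : u ^ 2 ≤ 25 := by
      rw [← sq_abs]
      nlinarith [abs_nonneg u]
    linarith

lemma dispersion_pi_le (x : ℝ) : dispersion x Real.pi ≤ |x - Real.pi| / 2 := by
  unfold dispersion
  rw [Real.cos_pi]
  apply Real.sqrt_le_iff.2 ⟨by positivity, ?_⟩
  have h := Real.one_sub_sq_div_two_le_cos (x := x - Real.pi)
  rw [Real.cos_sub_pi] at h
  rw [div_pow, sq_abs]
  linarith

/-! ### Lattice sums -/

lemma add_abs_mul_le_abs_sub_pi {n i : ℕ} {δ s : ℝ} (hδ : 0 ≤ δ) (hpi : Real.pi = 2 * n * δ)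
    (hi : n + 1 ≤ i ∨ i + 2 ≤ n) (hs : s ∈ Set.Icc (2 * i * δ) (2 * i * δ + 3 * δ)) :
    (1 + |(i : ℝ) - n|) * δ / 3 ≤ |s - Real.pi| := by
  obtain ⟨hs₁, hs₂⟩ := hs
  rw [hpi]
  rcases hi with hi | hi
  · have hi' : (n : ℝ) + 1 ≤ i := by exact_mod_cast hi
    rw [abs_of_nonneg (by linarith : (0 : ℝ) ≤ i - n)]
    refine le_trans ?_ (le_abs_self _)
    nlinarith
  · have hi' : (i : ℝ) + 2 ≤ n := by exact_mod_cast hi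
    rw [abs_of_nonpos (by linarith : (i : ℝ) - n ≤ 0)]
    refine le_trans ?_ (neg_le_abs _)
    nlinarith

lemma add_abs_mul_le_abs_shift_sub_pi {n k : ℕ} {δ t : ℝ} (hδ : 0 ≤ δ)
    (hpi : Real.pi = 2 * n * δ) (ht : t = 0 ∨ t = δ) (hkt : ¬(k = n ∧ t = 0)) :
    (1 + |(k : ℝ) - n|) * δ / 2 ≤ |2 * k * δ + t - Real.pi| := by
  have htI : 0 ≤ t ∧ t ≤ δ := by rcases ht with rfl | rfl <;> simp [hδ]
  obtain ⟨ht₁, ht₂⟩ := htI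
  rw [hpi]
  rcases lt_trichotomy k n with hk | hk | hk
  · have hk' : (k : ℝ) + 1 ≤ n := by exact_mod_cast hk
    rw [abs_of_nonpos (by linarith : (k : ℝ) - n ≤ 0)]
    refine le_trans ?_ (neg_le_abs _)
    nlinarith
  · have ht' : t = δ := by tauto
    rw [hk, ht', sub_self, abs_zero, add_sub_cancel_left, abs_of_nonneg hδ]
    linarith
  · have hk' : (n : ℝ) + 1 ≤ k := by exact_mod_cast hk
    rw [abs_of_nonneg (by linarith : (0 : ℝ) ≤ k - n)]
    refine le_trans ?_ (le_abs_self _)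
    nlinarith

lemma abs_third_difference_lattice_le_of_sq_add_sq {n i k : ℕ} {δ t : ℝ} (hn : 1 ≤ n)
    (hδ : 0 < δ) (hpi : Real.pi = 2 * n * δ) (hi : i < 2 * n) (hk : k < 2 * n)
    (ht : t ∈ Set.Icc 0 δ)
    (h : ∀ s ∈ Set.Icc (2 * i * δ) (2 * i * δ + 3 * δ),
      δ ^ 2 * ((1 + |(i : ℝ) - n|) * (1 + |(k : ℝ) - n|)) / 9 ≤
        (s - Real.pi) ^ 2 + (2 * k * δ + t - Real.pi) ^ 2) :
    |dispersion (2 * i * δ + 3 * δ) (2 * k * δ + t)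
      - 3 * dispersion (2 * i * δ + 2 * δ) (2 * k * δ + t)
      + 3 * dispersion (2 * i * δ + δ) (2 * k * δ + t)
      - dispersion (2 * i * δ) (2 * k * δ + t)| ≤
    900 * δ / ((1 + |(i : ℝ) - n|) * (1 + |(k : ℝ) - n|)) := by
  have hn' : (1 : ℝ) ≤ n := by exact_mod_cast hn
  have hi' : (i : ℝ) + 1 ≤ 2 * n := by exact_mod_cast hi
  have hk' : (k : ℝ) + 1 ≤ 2 * n := by exact_mod_cast hk
  have hi0 : (0 : ℝ) ≤ i := i.cast_nonneg
  have hk0 : (0 : ℝ) ≤ k := k.cast_nonneg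
  set w := (1 + |(i : ℝ) - n|) * (1 + |(k : ℝ) - n|)
  have hw : 0 < w := by positivity
  have hy : |2 * k * δ + t - Real.pi| ≤ 3 * Real.pi / 2 := by
    obtain ⟨ht₁, ht₂⟩ := ht
    rw [hpi, abs_le]
    constructor <;> nlinarith
  have hcosy := sq_sub_pi_div_le_one_add_cos hy
  refine (abs_third_difference_dispersion_le (m := δ ^ 2 * w / 450) hδ.le (by positivity)
    fun s hs => ?_).trans_eq ?_
  · have hx : |s - Real.pi| ≤ 3 * Real.pi / 2 := by
      obtain ⟨hs₁, hs₂⟩ := hs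
      rw [hpi, abs_le]
      constructor <;> nlinarith
    linarith [sq_sub_pi_div_le_one_add_cos hx, h s hs]
  · field_simp
    norm_num

lemma abs_third_difference_lattice_le {n i k : ℕ} {δ t : ℝ} (hn : 1 ≤ n)
    (hδ : 0 < δ) (hpi : Real.pi = 2 * n * δ) (hi : i < 2 * n) (hk : k < 2 * n)
    (ht : t = 0 ∨ t = δ) :
    |dispersion (2 * i * δ + 3 * δ) (2 * k * δ + t)
      - 3 * dispersion (2 * i * δ + 2 * δ) (2 * k * δ + t)
      + 3 * dispersion (2 * i * δ + δ) (2 * k * δ + t)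
      - dispersion (2 * i * δ) (2 * k * δ + t)| ≤
    900 * δ / ((1 + |(i : ℝ) - n|) * (1 + |(k : ℝ) - n|)) := by
  have htI : t ∈ Set.Icc 0 δ := by rcases ht with rfl | rfl <;> simp [hδ.le]
  have hd := abs_nonneg ((i : ℝ) - n)
  have he := abs_nonneg ((k : ℝ) - n)
  by_cases hki : (k = n ∧ t = 0) ∧ ¬(n + 1 ≤ i ∨ i + 2 ≤ n)
  · obtain ⟨⟨rfl, rfl⟩, hik⟩ := hki
    -- Every point of the window lies within `3 * δ` of the conical point.
    have hi₁ : (i : ℝ) ≤ k := by exact_mod_cast (by omega : i ≤ k)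
    have hi₂ : (k : ℝ) ≤ i + 1 := by exact_mod_cast (by omega : k ≤ i + 1)
    have hsmall : ∀ s ∈ Set.Icc (2 * i * δ) (2 * i * δ + 3 * δ),
        0 ≤ dispersion s Real.pi ∧ dispersion s Real.pi ≤ 3 / 2 * δ := by
      intro s hs
      refine ⟨Real.sqrt_nonneg _, (dispersion_pi_le s).trans ?_⟩
      have : |s - Real.pi| ≤ 3 * δ := by
        obtain ⟨hs₁, hs₂⟩ := hs
        rw [hpi, abs_le]
        constructor <;> nlinarith
      linarith
    have hb : 450 * δ ≤ 900 * δ / ((1 + |(i : ℝ) - k|) * (1 + |(k : ℝ) - k|)) := by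
      have : |(i : ℝ) - k| ≤ 1 := by rw [abs_le]; constructor <;> linarith
      rw [sub_self, abs_zero, le_div_iff₀ (by positivity)]
      nlinarith
    refine le_trans ?_ hb
    rw [add_zero, ← hpi]
    obtain ⟨l₀, u₀⟩ := hsmall (2 * i * δ) ⟨by linarith, by linarith⟩
    obtain ⟨l₁, u₁⟩ := hsmall (2 * i * δ + δ) ⟨by linarith, by linarith⟩
    obtain ⟨l₂, u₂⟩ := hsmall (2 * i * δ + 2 * δ) ⟨by linarith, by linarith⟩
    obtain ⟨l₃, u₃⟩ := hsmall (2 * i * δ + 3 * δ) ⟨by linarith, by linarith⟩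
    rw [abs_le]
    constructor <;> linarith
  · refine abs_third_difference_lattice_le_of_sq_add_sq hn hδ hpi hi hk htI fun s hs => ?_
    set d := |(i : ℝ) - n|
    set e := |(k : ℝ) - n| with he_def
    rw [← sq_abs (s - _), ← sq_abs (_ + t - _)]
    by_cases hkt : k = n ∧ t = 0
    · have hi' : n + 1 ≤ i ∨ i + 2 ≤ n := by tauto
      have he0 : e = 0 := by rw [he_def, hkt.1, sub_self, abs_zero]
      have h := pow_le_pow_left₀ (by positivity) (add_abs_mul_le_abs_sub_pi hδ.le hpi hi' hs) 2
      rw [he0]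
      nlinarith [sq_nonneg δ, sq_nonneg |2 * k * δ + t - Real.pi|,
        mul_nonneg (sq_nonneg δ) hd, mul_nonneg (sq_nonneg δ) (mul_nonneg hd hd)]
    · have hy := pow_le_pow_left₀ (by positivity)
        (add_abs_mul_le_abs_shift_sub_pi hδ.le hpi ht hkt) 2
      by_cases hi' : n + 1 ≤ i ∨ i + 2 ≤ n
      · have hx := pow_le_pow_left₀ (by positivity) (add_abs_mul_le_abs_sub_pi hδ.le hpi hi' hs) 2
        nlinarith [sq_nonneg ((1 + d) * δ - (1 + e) * δ), sq_nonneg ((1 + e) * δ),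
          sq_nonneg ((1 + d) * δ)]
      · have hd1 : d ≤ 1 := by
          have hi₁ : (i : ℝ) ≤ n := by exact_mod_cast (by omega : i ≤ n)
          have hi₂ : (n : ℝ) ≤ i + 1 := by exact_mod_cast (by omega : n ≤ i + 1)
          rw [abs_le]; constructor <;> linarith
        have h1 : (1 + d) * (1 + e) ≤ 2 * (1 + e) ^ 2 := by nlinarith
        have h2 := mul_le_mul_of_nonneg_left h1 (sq_nonneg δ)
        nlinarith [sq_nonneg |s - Real.pi|, sq_nonneg ((1 + e) * δ)]

lemma sum_one_div_add_one_le {n : ℕ} :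
    ∑ m ∈ Finset.range n, 1 / (1 + (m : ℝ)) ≤ 1 + Real.log n := by
  have h := harmonic_le_one_add_log n
  simpa [harmonic, add_comm] using h

lemma sum_one_div_add_abs_sub_le {n : ℕ} :
    ∑ i ∈ Finset.range (2 * n), 1 / (1 + |(i : ℝ) - n|) ≤ 2 * (1 + Real.log n) := by
  rw [two_mul n, Finset.sum_range_add, ← Finset.sum_range_reflect]
  have h₁ : ∑ j ∈ Finset.range n, 1 / (1 + |((n - 1 - j : ℕ) : ℝ) - n|) ≤
      ∑ m ∈ Finset.range n, 1 / (1 + (m : ℝ)) := by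
    refine Finset.sum_le_sum fun j hj => ?_
    have hj' : n - 1 - j + (j + 1) = n := by have := Finset.mem_range.1 hj; omega
    have hj'' : ((n - 1 - j : ℕ) : ℝ) + (j + 1) = n := by exact_mod_cast hj'
    have : |((n - 1 - j : ℕ) : ℝ) - n| = j + 1 := by
      rw [← abs_neg, abs_of_nonneg] <;> linarith [(j.cast_nonneg : (0 : ℝ) ≤ j)]
    rw [this]
    apply one_div_le_one_div_of_le <;> linarith [(j.cast_nonneg : (0 : ℝ) ≤ j)]
  have h₂ : ∑ x ∈ Finset.range n, 1 / (1 + |((n + x : ℕ) : ℝ) - n|) =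
      ∑ m ∈ Finset.range n, 1 / (1 + (m : ℝ)) := by
    simp
  rw [h₂]
  linarith [sum_one_div_add_one_le (n := n)]

lemma abs_sum_dispersion_shift_le {n : ℕ} {δ t : ℝ} (hn : 1 ≤ n) (hδ : 0 < δ)
    (hpi : Real.pi = 2 * n * δ) (ht : t = 0 ∨ t = δ) :
    |∑ k ∈ Finset.range (2 * n), ∑ i ∈ Finset.range (2 * n),
      (dispersion (2 * i * δ + δ) (2 * k * δ + t) - dispersion (2 * i * δ) (2 * k * δ + t))| ≤
    900 * δ * (1 + Real.log n) ^ 2 := by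
  set w : ℕ → ℝ := fun i => 1 / (1 + |(i : ℝ) - n|) with hw
  have hrow : ∀ k ∈ Finset.range (2 * n), |∑ i ∈ Finset.range (2 * n),
      (dispersion (2 * i * δ + δ) (2 * k * δ + t) - dispersion (2 * i * δ) (2 * k * δ + t))| ≤
      ∑ i ∈ Finset.range (2 * n), 225 * δ * (w k * w i) := by
    intro k hk
    have hper : Function.Periodic (fun x => dispersion x (2 * k * δ + t))
        (2 * (2 * n : ℕ) * δ) := by
      convert dispersion_periodic (2 * k * δ + t) using 1
      rw [hpi]
      push_cast
      ring
    have h := sum_third_difference hper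
    have h' : |4 * ∑ i ∈ Finset.range (2 * n),
        (dispersion (2 * i * δ + δ) (2 * k * δ + t) - dispersion (2 * i * δ) (2 * k * δ + t))| ≤
        ∑ i ∈ Finset.range (2 * n), 900 * δ * (w k * w i) := by
      rw [← h]
      refine (Finset.abs_sum_le_sum_abs _ _).trans (Finset.sum_le_sum fun i hi => ?_)
      refine (abs_third_difference_lattice_le hn hδ hpi (Finset.mem_range.1 hi)
        (Finset.mem_range.1 hk) ht).trans_eq ?_
      simp only [hw]
      field_simp
    rw [abs_mul, abs_of_pos (by norm_num : (0 : ℝ) < 4)] at h'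
    simp only [← Finset.mul_sum] at h' ⊢
    linarith
  refine (Finset.abs_sum_le_sum_abs _ _).trans ((Finset.sum_le_sum hrow).trans ?_)
  simp only [← Finset.mul_sum, ← Finset.sum_mul]
  have hS := sum_one_div_add_abs_sub_le (n := n)
  have hS0 : 0 ≤ ∑ i ∈ Finset.range (2 * n), w i :=
    Finset.sum_nonneg fun i _ => by positivity
  have := pow_le_pow_left₀ hS0 hS 2
  nlinarith [mul_le_mul_of_nonneg_left this hδ.le]

lemma abs_sum_dispersion_shift_shift_le {n : ℕ} {δ s t : ℝ} (hn : 1 ≤ n) (hδ : 0 < δ)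
    (hpi : Real.pi = 2 * n * δ) (hs : s = 0 ∨ s = δ) (ht : t = 0 ∨ t = δ) :
    |∑ i ∈ Finset.range (2 * n), ∑ k ∈ Finset.range (2 * n),
      (dispersion (2 * i * δ + s) (2 * k * δ + t) - dispersion (2 * i * δ) (2 * k * δ))| ≤
    1800 * δ * (1 + Real.log n) ^ 2 := by
  have hx : |∑ k ∈ Finset.range (2 * n), ∑ i ∈ Finset.range (2 * n),
      (dispersion (2 * i * δ + s) (2 * k * δ + t) - dispersion (2 * i * δ) (2 * k * δ + t))| ≤
      900 * δ * (1 + Real.log n) ^ 2 := by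
    rcases hs with rfl | rfl
    · simp only [add_zero, sub_self, Finset.sum_const_zero, abs_zero]
      positivity
    · exact abs_sum_dispersion_shift_le hn hδ hpi ht
  have hy : |∑ i ∈ Finset.range (2 * n), ∑ k ∈ Finset.range (2 * n),
      (dispersion (2 * i * δ) (2 * k * δ + t) - dispersion (2 * i * δ) (2 * k * δ))| ≤
      900 * δ * (1 + Real.log n) ^ 2 := by
    rcases ht with rfl | rfl
    · simp only [add_zero, sub_self, Finset.sum_const_zero, abs_zero]
      positivity
    · simpa [dispersion_comm] using abs_sum_dispersion_shift_le hn hδ hpi (Or.inl rfl)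
  rw [Finset.sum_comm] at hx
  refine le_trans (le_of_eq ?_) ((abs_add_le _ _).trans ((add_le_add hx hy).trans_eq ?_))
  · simp only [← Finset.sum_add_distrib, sub_add_sub_cancel]
  · ring

lemma sq_one_add_log_le {α x : ℝ} (hα : 0 < α) (hx : 1 ≤ x) :
    (1 + Real.log x) ^ 2 ≤ (1 + 1 / α) ^ 2 * x ^ (2 * α) := by
  have h := Real.log_le_rpow_div (zero_le_one.trans hx) hα
  have h1 := Real.one_le_rpow hx hα.le
  have h0 := Real.log_nonneg hx
  have e : x ^ (2 * α) = (x ^ α) ^ 2 := by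
    rw [mul_comm, Real.rpow_mul (zero_le_one.trans hx)]
    norm_num
  rw [e, ← mul_pow]
  refine pow_le_pow_left₀ (by linarith) ?_ 2
  rw [add_mul, one_mul, one_div_mul_eq_div]
  linarith

/-- **Near-degeneracy of the π-flux ground state energies (`L = 4n` case).**
With `f(x,y) = −√(1 + cos x / 2 + cos y / 2)`, the difference between the lattice
sums of the dispersion with and without the flux shifts `(a,b)` on the
non-contractible loops is bounded by `C_α · n^{3α−1}` for any `0 < α < 1/3`. -/
theorem pi_flux_energy_difference_even (α : ℝ) (hα₀ : 0 < α) (hα : α < 1 / 3) :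
    ∃ C : ℝ, 0 < C ∧
      ∀ n : ℕ, 1 ≤ n → ∀ a b : ℝ, (a = 1 ∨ a = -1) → (b = 1 ∨ b = -1) →
        |∑ n₁ ∈ Finset.range (2 * n), ∑ n₂ ∈ Finset.range (2 * n),
            ((-Real.sqrt (1 +
                Real.cos (Real.pi * n₁ / n - Real.pi * (a - 1) / (4 * n)) / 2 +
                Real.cos (Real.pi * n₂ / n - Real.pi * (b - 1) / (4 * n)) / 2)) -
             (-Real.sqrt (1 + Real.cos (Real.pi * n₁ / n) / 2 +
                Real.cos (Real.pi * n₂ / n) / 2)))| ≤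
          C * (n : ℝ) ^ (3 * α - 1) := by
  refine ⟨1800 * (Real.pi / 2) * (1 + 1 / α) ^ 2, by positivity, fun n hn a b ha hb => ?_⟩
  have hn' : (1 : ℝ) ≤ n := by exact_mod_cast hn
  have hn0 : (0 : ℝ) < n := by linarith
  have hpi := Real.pi_pos
  set δ := Real.pi / (2 * n) with hδ_def
  have hδ : 0 < δ := by positivity
  have hs : ∀ c : ℝ, (c = 1 ∨ c = -1) → δ * ((1 - c) / 2) = 0 ∨ δ * ((1 - c) / 2) = δ := by
    rintro c (rfl | rfl) <;> norm_num
  have hx : ∀ (c : ℝ) (i : ℕ), Real.pi * i / n - Real.pi * (c - 1) / (4 * n) =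
      2 * i * δ + δ * ((1 - c) / 2) := fun c i => by
    rw [hδ_def]; field_simp; ring
  have hx0 : ∀ i : ℕ, Real.pi * i / n = 2 * i * δ := fun i => by
    rw [hδ_def]; field_simp
  have h := abs_sum_dispersion_shift_shift_le hn hδ (by rw [hδ_def]; field_simp)
    (hs a ha) (hs b hb)
  rw [← abs_neg] at h
  refine le_trans (le_of_eq ?_) (h.trans ?_)
  · simp only [← Finset.sum_neg_distrib]
    congr 1
    refine Finset.sum_congr rfl fun i _ => Finset.sum_congr rfl fun k _ => ?_
    rw [hx a i, hx b k, hx0 i, hx0 k]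
    unfold dispersion
    ring
  · have hlog := sq_one_add_log_le hα₀ hn'
    have hexp : (n : ℝ) ^ (2 * α) ≤ (n : ℝ) ^ (3 * α) :=
      Real.rpow_le_rpow_of_exponent_le hn' (by linarith)
    rw [Real.rpow_sub_one hn0.ne']
    calc 1800 * δ * (1 + Real.log n) ^ 2
        ≤ 1800 * δ * ((1 + 1 / α) ^ 2 * (n : ℝ) ^ (3 * α)) := by
          gcongr
          exact hlog.trans (by gcongr)
      _ = _ := by rw [hδ_def]; field_simp
end

section
/- Let ℓ ≥ 1, L = 4ℓ and t > 0. Then for every (a,b) ∈ {−1,1}²: Σ_{k ∈ B_L(a,b)} e₋(k) ≥ Σ_{k ∈ B_L(−1,−1)} e₋(k). That is, among the four π-flux phases, the fermionic ground state energy at half-filling is minimized by the one with flux π through both non-contractible loops of the torus. -/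
open Polynomial in
/-- Polynomial approximations, with nonnegative coefficients, of `x ↦ 1 - √(1 - x)`. -/
noncomputable def sqrtApprox : ℕ → ℝ[X]
  | 0 => 0
  | n + 1 => C (1 / 2) * (X + sqrtApprox n * sqrtApprox n)

open Polynomial in
theorem sqrtApprox_coeff_nonneg (n k : ℕ) : 0 ≤ (sqrtApprox n).coeff k := by
  induction n generalizing k with
  | zero => simp [sqrtApprox]
  | succ n ih =>
    rw [sqrtApprox, coeff_C_mul, coeff_add, coeff_X]
    have h : 0 ≤ (sqrtApprox n * sqrtApprox n).coeff k := by
      rw [coeff_mul]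
      exact Finset.sum_nonneg fun p _ => mul_nonneg (ih _) (ih _)
    have h' : (0 : ℝ) ≤ if 1 = k then 1 else 0 := by split_ifs <;> norm_num
    positivity

theorem sqrtApprox_eval_succ (n : ℕ) (x : ℝ) :
    (sqrtApprox (n + 1)).eval x = (x + (sqrtApprox n).eval x ^ 2) / 2 := by
  simp [sqrtApprox]
  ring

open Filter Topology in
theorem tendsto_sqrtApprox_eval {r x : ℝ} (hr : r < 1) (hx : |x| ≤ r) :
    Tendsto (fun n => (sqrtApprox n).eval x) atTop (𝓝 (1 - √(1 - x))) := by
  obtain ⟨hx₁, hx₂⟩ := abs_le.1 hx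
  have hr0 : 0 ≤ r := (abs_nonneg x).trans hx
  set W := 1 - √(1 - r) with hW
  set w := 1 - √(1 - x) with hw
  have hWsq : W = (r + W ^ 2) / 2 := by
    have := Real.sq_sqrt (show 0 ≤ 1 - r by linarith)
    rw [hW]; linarith
  have hwsq : w = (x + w ^ 2) / 2 := by
    have := Real.sq_sqrt (show 0 ≤ 1 - x by linarith)
    rw [hw]; linarith
  have hW1 : W < 1 := by
    have := Real.sqrt_pos.2 (show 0 < 1 - r by linarith)
    linarith
  have hW0 : 0 ≤ W := by
    have : √(1 - r) ≤ 1 := Real.sqrt_le_one.2 (by linarith)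
    linarith
  have hw1 : w ≤ W := by
    have := Real.sqrt_le_sqrt (show 1 - r ≤ 1 - x by linarith)
    linarith
  have hw2 : -W ≤ w := by
    have h₁ := Real.sq_sqrt (show 0 ≤ 1 - r by linarith)
    have : √(1 - x) ≤ 2 - √(1 - r) := by
      apply Real.sqrt_le_iff.2
      constructor
      · linarith
      · nlinarith [sq_nonneg W]
    linarith
  have hbound : ∀ n, |(sqrtApprox n).eval x| ≤ W := by
    intro n
    induction n with
    | zero => simpa [sqrtApprox] using hW0
    | succ n ih =>
      have h := sq_le_sq' (abs_le.1 ih).1 (abs_le.1 ih).2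
      have h0 := sq_nonneg ((sqrtApprox n).eval x)
      rw [sqrtApprox_eval_succ, abs_le]
      constructor <;> nlinarith
  have hdist : ∀ n, |(sqrtApprox n).eval x - w| ≤ W ^ n * |w| := by
    intro n
    induction n with
    | zero => simp [sqrtApprox]
    | succ n ih =>
      have hfac : (sqrtApprox (n + 1)).eval x - w =
          (((sqrtApprox n).eval x + w) / 2) * ((sqrtApprox n).eval x - w) := by
        rw [sqrtApprox_eval_succ]
        linear_combination -hwsq
      have hs : |((sqrtApprox n).eval x + w) / 2| ≤ W := by
        have := abs_le.1 (hbound n)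
        rw [abs_le]
        constructor <;> linarith
      rw [hfac, abs_mul, pow_succ', mul_assoc]
      exact mul_le_mul hs ih (abs_nonneg _) hW0
  rw [tendsto_iff_dist_tendsto_zero]
  simp only [Real.dist_eq]
  refine squeeze_zero (fun _ => abs_nonneg _) hdist ?_
  simpa using (tendsto_pow_atTop_nhds_zero_of_lt_one hW0 hW1).mul_const |w|

/-- A family whose power sums are all dominated has the larger sum of `√(1 - ·)`. -/
theorem sum_sqrt_one_sub_le_of_sum_pow_le {ι : Type*} (s : Finset ι) (x y : ι → ℝ)
    (hx : ∀ i ∈ s, |x i| ≤ 1) (hy : ∀ i ∈ s, |y i| ≤ 1)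
    (h : ∀ k : ℕ, ∑ i ∈ s, x i ^ k ≤ ∑ i ∈ s, y i ^ k) :
    ∑ i ∈ s, √(1 - y i) ≤ ∑ i ∈ s, √(1 - x i) := by
  have key : ∀ r : ℝ, 0 < r → r < 1 →
      ∑ i ∈ s, √(1 - r * y i) ≤ ∑ i ∈ s, √(1 - r * x i) := by
    intro r hr0 hr1
    have hlim : ∀ z : ι → ℝ, (∀ i ∈ s, |z i| ≤ 1) →
        Filter.Tendsto (fun n => ∑ i ∈ s, (sqrtApprox n).eval (r * z i)) Filter.atTop
          (nhds (∑ i ∈ s, (1 - √(1 - r * z i)))) := by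
      intro z hz
      refine tendsto_finsetSum s fun i hi => tendsto_sqrtApprox_eval hr1 ?_
      rw [abs_mul, abs_of_pos hr0]
      exact mul_le_of_le_one_right hr0.le (hz i hi)
    have hle := le_of_tendsto_of_tendsto' (hlim x hx) (hlim y hy) fun n => by
      simp only [Polynomial.eval_eq_sum_range, mul_pow]
      rw [Finset.sum_comm, Finset.sum_comm (s := s)]
      refine Finset.sum_le_sum fun k _ => ?_
      simp only [← mul_assoc, ← Finset.mul_sum]
      exact mul_le_mul_of_nonneg_left (h k)
        (mul_nonneg (sqrtApprox_coeff_nonneg n k) (pow_nonneg hr0.le k))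
    simp only [Finset.sum_sub_distrib] at hle
    linarith
  have hlim : ∀ z : ι → ℝ, Filter.Tendsto (fun r : ℝ => ∑ i ∈ s, √(1 - r * z i))
      (nhdsWithin 1 (Set.Iio 1)) (nhds (∑ i ∈ s, √(1 - z i))) := by
    intro z
    have hc : Continuous fun r : ℝ => ∑ i ∈ s, √(1 - r * z i) := by fun_prop
    simpa using (hc.tendsto 1).mono_left nhdsWithin_le_nhds
  refine le_of_tendsto_of_tendsto (hlim y) (hlim x) ?_
  filter_upwards [Ioo_mem_nhdsLT (show (0 : ℝ) < 1 by norm_num)] with r hr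
  exact key r hr.1 hr.2

/-- Shifting the grid of angles `(π / ℓ) n`, `n < 2ℓ`, does not increase the absolute value of
the sum of `cos (m θ)`. -/
theorem abs_sum_cos_le_sum_cos (ℓ : ℕ) (hℓ : 1 ≤ ℓ) (m : ℤ) (φ : ℝ) :
    |∑ n ∈ Finset.range (2 * ℓ), Real.cos (m * (Real.pi / ℓ * (n + φ)))| ≤
      ∑ n ∈ Finset.range (2 * ℓ), Real.cos (m * (Real.pi / ℓ * n)) := by
  have hℓ0 : (ℓ : ℝ) ≠ 0 := by positivity
  by_cases hs : Real.sin (m * (Real.pi / ℓ) / 2) = 0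
  · obtain ⟨k, hk⟩ := Real.sin_eq_zero_iff.1 hs
    have h1 : ∀ n : ℕ, Real.cos (m * (Real.pi / ℓ * n)) = 1 := by
      intro n
      have : (m : ℝ) * (Real.pi / ℓ * n) = ((k * n : ℤ) : ℝ) * (2 * Real.pi) := by
        push_cast
        linear_combination -2 * (n : ℝ) * hk
      rw [this, Real.cos_int_mul_two_pi]
    refine (Finset.abs_sum_le_sum_abs _ _).trans (Finset.sum_le_sum fun n _ => ?_)
    rw [h1]
    exact Real.abs_cos_le_one _
  · have hzero : ∀ ψ : ℝ,
        ∑ n ∈ Finset.range (2 * ℓ), Real.cos (m * (Real.pi / ℓ * (n + ψ))) = 0 := by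
      intro ψ
      have htel := Finset.sum_range_sub
        (fun n : ℕ => Real.sin (m * (Real.pi / ℓ) * (n + ψ - 1 / 2))) (2 * ℓ)
      have hper : (m : ℝ) * (Real.pi / ℓ) * ((2 * ℓ : ℕ) + ψ - 1 / 2) =
          m * (Real.pi / ℓ) * ((0 : ℕ) + ψ - 1 / 2) + m * (2 * Real.pi) := by
        push_cast
        field_simp
        ring
      rw [hper, Real.sin_add_int_mul_two_pi, sub_self] at htel
      have hterm : ∀ n : ℕ, Real.sin (m * (Real.pi / ℓ) * ((n + 1 : ℕ) + ψ - 1 / 2)) -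
          Real.sin (m * (Real.pi / ℓ) * (n + ψ - 1 / 2)) =
          2 * Real.sin (m * (Real.pi / ℓ) / 2) * Real.cos (m * (Real.pi / ℓ * (n + ψ))) := by
        intro n
        rw [Real.sin_sub_sin]
        congr 3 <;> push_cast <;> ring
      simp only [hterm, ← Finset.mul_sum] at htel
      exact (mul_eq_zero.1 htel).resolve_left (mul_ne_zero two_ne_zero hs)
    have h0 := hzero 0
    simp only [add_zero] at h0
    rw [hzero φ, h0, abs_zero]

theorem abs_sum_cos_pow_mul_cos_le (ℓ : ℕ) (hℓ : 1 ≤ ℓ) (φ : ℝ) (j : ℕ) (m : ℤ) :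
    |∑ n ∈ Finset.range (2 * ℓ), Real.cos (Real.pi / ℓ * (n + φ)) ^ j *
        Real.cos (m * (Real.pi / ℓ * (n + φ)))| ≤
      ∑ n ∈ Finset.range (2 * ℓ), Real.cos (Real.pi / ℓ * n) ^ j *
        Real.cos (m * (Real.pi / ℓ * n)) := by
  induction j generalizing m with
  | zero => simpa using abs_sum_cos_le_sum_cos ℓ hℓ m φ
  | succ j ih =>
    have hprod : ∀ θ : ℝ, Real.cos θ ^ (j + 1) * Real.cos (m * θ) =
        (Real.cos θ ^ j * Real.cos ((m + 1 : ℤ) * θ) +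
          Real.cos θ ^ j * Real.cos ((m - 1 : ℤ) * θ)) / 2 := by
      intro θ
      push_cast
      rw [add_mul, sub_mul, one_mul, Real.cos_add, Real.cos_sub]
      ring
    simp only [hprod, ← Finset.sum_div, Finset.sum_add_distrib]
    rw [abs_div, abs_two]
    have := abs_add_le
      (∑ n ∈ Finset.range (2 * ℓ), Real.cos (Real.pi / ℓ * (n + φ)) ^ j *
        Real.cos ((m + 1 : ℤ) * (Real.pi / ℓ * (n + φ))))
      (∑ n ∈ Finset.range (2 * ℓ), Real.cos (Real.pi / ℓ * (n + φ)) ^ j *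
        Real.cos ((m - 1 : ℤ) * (Real.pi / ℓ * (n + φ))))
    linarith [ih (m + 1), ih (m - 1)]

theorem sum_cos_pow_le (ℓ : ℕ) (hℓ : 1 ≤ ℓ) (φ : ℝ) (j : ℕ) :
    ∑ n ∈ Finset.range (2 * ℓ), Real.cos (Real.pi / ℓ * (n + φ)) ^ j ≤
      ∑ n ∈ Finset.range (2 * ℓ), Real.cos (Real.pi / ℓ * n) ^ j := by
  simpa using (le_abs_self _).trans (abs_sum_cos_pow_mul_cos_le ℓ hℓ φ j 0)

theorem sum_cos_pow_eq_zero_of_odd (ℓ : ℕ) (hℓ : 1 ≤ ℓ) (φ : ℝ) {j : ℕ} (hj : Odd j) :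
    ∑ n ∈ Finset.range (2 * ℓ), Real.cos (Real.pi / ℓ * (n + φ)) ^ j = 0 := by
  have hℓ0 : (ℓ : ℝ) ≠ 0 := by positivity
  rw [two_mul, Finset.sum_range_add, ← Finset.sum_add_distrib]
  refine Finset.sum_eq_zero fun n _ => ?_
  have : Real.pi / ℓ * ((ℓ + n : ℕ) + φ) = Real.pi / ℓ * (n + φ) + Real.pi := by
    push_cast
    field_simp
    ring
  rw [this, Real.cos_add_pi, hj.neg_pow, add_neg_cancel]

/-- For the shifts `0` and `1 / 2` of the angle grid, the half-shifted grid minimizes every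
power sum of `-(cos θ + cos η) / 2`. -/
theorem sum_pow_half_shift_le (ℓ : ℕ) (hℓ : 1 ≤ ℓ) (φ ψ : ℝ)
    (hφ : φ = 0 ∨ φ = 1 / 2) (hψ : ψ = 0 ∨ ψ = 1 / 2) (k : ℕ) :
    ∑ n ∈ Finset.range (2 * ℓ) ×ˢ Finset.range (2 * ℓ),
      (-(Real.cos (Real.pi / ℓ * (n.1 + 1 / 2)) + Real.cos (Real.pi / ℓ * (n.2 + 1 / 2))) / 2) ^ k ≤
    ∑ n ∈ Finset.range (2 * ℓ) ×ˢ Finset.range (2 * ℓ),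
      (-(Real.cos (Real.pi / ℓ * (n.1 + φ)) + Real.cos (Real.pi / ℓ * (n.2 + ψ))) / 2) ^ k := by
  set S : ℝ → ℕ → ℝ := fun φ j =>
    ∑ n ∈ Finset.range (2 * ℓ), Real.cos (Real.pi / ℓ * (n + φ)) ^ j with hS
  have hexp : ∀ φ ψ : ℝ, ∑ n ∈ Finset.range (2 * ℓ) ×ˢ Finset.range (2 * ℓ),
      (-(Real.cos (Real.pi / ℓ * (n.1 + φ)) + Real.cos (Real.pi / ℓ * (n.2 + ψ))) / 2) ^ k =
      ∑ i ∈ Finset.range (k + 1), (-1 / 2) ^ k * (k.choose i) * (S φ i * S ψ (k - i)) := by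
    intro φ ψ
    have hterm : ∀ x y : ℝ, (-(x + y) / 2) ^ k =
        ∑ i ∈ Finset.range (k + 1), (-1 / 2) ^ k * (k.choose i) * (x ^ i * y ^ (k - i)) := by
      intro x y
      rw [show -(x + y) / 2 = (-1 / 2) * (x + y) by ring, mul_pow, add_pow, Finset.mul_sum]
      exact Finset.sum_congr rfl fun i _ => by ring
    simp only [hterm]
    rw [Finset.sum_comm]
    refine Finset.sum_congr rfl fun i _ => ?_
    rw [← Finset.mul_sum, Finset.sum_mul_sum, ← Finset.sum_product']
  have hle : ∀ φ : ℝ, φ = 0 ∨ φ = 1 / 2 → ∀ j, S (1 / 2) j ≤ S φ j := by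
    rintro φ (rfl | rfl) j
    · simpa [hS] using sum_cos_pow_le ℓ hℓ (1 / 2) j
    · exact le_rfl
  have hnonneg : ∀ (φ : ℝ) {j : ℕ}, Even j → 0 ≤ S φ j := fun φ _ hj =>
    Finset.sum_nonneg fun _ _ => hj.pow_nonneg _
  have hodd : ∀ (φ : ℝ) {j : ℕ}, ¬ Even j → S φ j = 0 := fun φ _ hj =>
    sum_cos_pow_eq_zero_of_odd ℓ hℓ φ (Nat.not_even_iff_odd.1 hj)
  rw [hexp, hexp]
  refine Finset.sum_le_sum fun i hi => ?_
  by_cases h₁ : Even i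
  · by_cases h₂ : Even (k - i)
    · have hk : Even k := by
        have := h₁.add h₂
        rwa [Nat.add_sub_cancel' (Nat.lt_succ_iff.1 (Finset.mem_range.1 hi))] at this
      exact mul_le_mul_of_nonneg_left
        (mul_le_mul (hle φ hφ i) (hle ψ hψ _) (hnonneg _ h₂) (hnonneg _ h₁))
        (mul_nonneg (hk.pow_nonneg _) (Nat.cast_nonneg _))
    · simp [hodd _ h₂]
  · simp [hodd _ h₁]

theorem sum_sqrt_le_half_shift (ℓ : ℕ) (hℓ : 1 ≤ ℓ) (φ ψ : ℝ)
    (hφ : φ = 0 ∨ φ = 1 / 2) (hψ : ψ = 0 ∨ ψ = 1 / 2) :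
    ∑ n₁ ∈ Finset.range (2 * ℓ), ∑ n₂ ∈ Finset.range (2 * ℓ),
      √(1 + Real.cos (Real.pi / ℓ * (n₁ + φ)) / 2 + Real.cos (Real.pi / ℓ * (n₂ + ψ)) / 2) ≤
    ∑ n₁ ∈ Finset.range (2 * ℓ), ∑ n₂ ∈ Finset.range (2 * ℓ),
      √(1 + Real.cos (Real.pi / ℓ * (n₁ + 1 / 2)) / 2 +
        Real.cos (Real.pi / ℓ * (n₂ + 1 / 2)) / 2) := by
  have hb : ∀ θ η : ℝ, |-(Real.cos θ + Real.cos η) / 2| ≤ 1 := by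
    intro θ η
    rw [abs_le]
    constructor <;>
      linarith [Real.cos_le_one θ, Real.cos_le_one η, Real.neg_one_le_cos θ, Real.neg_one_le_cos η]
  have h := sum_sqrt_one_sub_le_of_sum_pow_le _ _ _ (fun _ _ => hb _ _) (fun _ _ => hb _ _)
    (sum_pow_half_shift_le ℓ hℓ φ ψ hφ hψ)
  rw [Finset.sum_product, Finset.sum_product] at h
  convert h using 5 <;> ring


/-- **The (−1,−1) π-flux phase minimizes the fermionic ground state energy.**
With `L = 4ℓ`, `e₋(k) = −2t√(1 + cos(2k₁)/2 + cos(2k₂)/2)` and the Brillouin zone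
`B_L(a,b) = {((2π/L)(n₁ − (a−1)/4), (2π/L)(n₂ − (b−1)/4)) : 0 ≤ n₁ < L, 0 ≤ n₂ < L/2}`,
the half-filled ground state energy `Σ_{k ∈ B_L(a,b)} e₋(k)` is minimized at
`(a,b) = (−1,−1)`. -/
theorem pi_flux_ground_state_minimizer (ℓ L : ℕ) (hℓ : 1 ≤ ℓ) (hL : L = 4 * ℓ)
    (t : ℝ) (ht : 0 < t) :
    let E : ℝ → ℝ → ℝ := fun a b =>
      ∑ n₁ ∈ Finset.range L, ∑ n₂ ∈ Finset.range (L / 2),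
        -2 * t * Real.sqrt (1 +
          Real.cos (2 * (2 * Real.pi / L * ((n₁ : ℝ) - (a - 1) / 4))) / 2 +
          Real.cos (2 * (2 * Real.pi / L * ((n₂ : ℝ) - (b - 1) / 4))) / 2)
    ∀ a b : ℝ, (a = 1 ∨ a = -1) → (b = 1 ∨ b = -1) → E a b ≥ E (-1) (-1) := by
  intro E a b ha hb
  have hℓ0 : (ℓ : ℝ) ≠ 0 := by positivity
  set F : ℝ → ℝ → ℝ := fun φ ψ =>
    ∑ n₁ ∈ Finset.range (2 * ℓ), ∑ n₂ ∈ Finset.range (2 * ℓ),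
      √(1 + Real.cos (Real.pi / ℓ * (n₁ + φ)) / 2 + Real.cos (Real.pi / ℓ * (n₂ + ψ)) / 2) with hF
  have hangle : ∀ (n : ℕ) (c : ℝ), 2 * (2 * Real.pi / L * ((n : ℝ) - (c - 1) / 4)) =
      Real.pi / ℓ * (n + (1 - c) / 4) := by
    intro n c
    rw [hL]
    push_cast
    field_simp
    ring
  have hE : ∀ a b : ℝ, E a b = -4 * t * F ((1 - a) / 4) ((1 - b) / 4) := by
    intro a b
    have hL₂ : L / 2 = 2 * ℓ := by omega
    have hL₁ : L = 2 * ℓ + 2 * ℓ := by omega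
    have hshift : ∀ (n : ℕ) (φ : ℝ), Real.cos (Real.pi / ℓ * ((2 * ℓ + n : ℕ) + φ)) =
        Real.cos (Real.pi / ℓ * (n + φ)) := by
      intro n φ
      rw [← Real.cos_add_two_pi (Real.pi / ℓ * (n + φ))]
      congr 1
      push_cast
      field_simp
      ring
    simp only [E, hangle, hL₂, ← Finset.mul_sum]
    rw [hL₁, Finset.sum_range_add]
    simp only [hshift, hF]
    ring
  have hval : ∀ c : ℝ, c = 1 ∨ c = -1 → (1 - c) / 4 = 0 ∨ (1 - c) / 4 = 1 / 2 := by
    rintro c (rfl | rfl) <;> norm_num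
  have hmax := sum_sqrt_le_half_shift ℓ hℓ _ _ (hval a ha) (hval b hb)
  rw [hE, hE, show (1 - (-1 : ℝ)) / 4 = 1 / 2 by norm_num, ge_iff_le]
  exact mul_le_mul_of_nonpos_left hmax (by linarith)
end

section
/- For every v > 0, every p ∈ ℝ, and every (ω, k₁) ∈ ℝ² with a := ω² + k₁² > 0: (1/(2π))·∫_ℝ [ k₂·(k₂ − v·p) / ((a + k₂²)·(a + (k₂ − v·p)²)) − k₂² / (a + k₂²)² ] dk₂ = − v²·p² / ( 4·√a · (v²·p² + 4·a) ). -/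
open MeasureTheory

open Filter Topology in
/-- A ratio of monic quadratics has logarithm tending to zero at infinity. -/
lemma tendsto_log_quadratic_ratio {s : ℝ} (b : ℝ) {l : Filter ℝ}
    (h0 : Tendsto (fun x : ℝ => x⁻¹) l (𝓝 0)) (hne : ∀ᶠ x in l, x ≠ 0) :
    Tendsto (fun x : ℝ => Real.log ((s ^ 2 + x ^ 2) / (s ^ 2 + (x - b) ^ 2))) l (𝓝 0) := by
  have hc : ContinuousAt (fun t : ℝ =>
      Real.log ((s ^ 2 * t ^ 2 + 1) / (s ^ 2 * t ^ 2 + (1 - b * t) ^ 2))) 0 := by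
    refine ContinuousAt.log (ContinuousAt.div (by fun_prop) (by fun_prop) ?_) ?_ <;> norm_num
  have h := hc.tendsto.comp h0
  simp only [ne_eq, OfNat.ofNat_ne_zero, not_false_eq_true, zero_pow, mul_zero, zero_add,
    sub_zero, one_pow, div_one, Real.log_one] at h
  refine h.congr' ?_
  filter_upwards [hne] with x hx
  have e1 : s ^ 2 * x⁻¹ ^ 2 + 1 = (s ^ 2 + x ^ 2) * (x⁻¹) ^ 2 := by field_simp
  have e2 : s ^ 2 * x⁻¹ ^ 2 + (1 - b * x⁻¹) ^ 2 = (s ^ 2 + (x - b) ^ 2) * (x⁻¹) ^ 2 := by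
    field_simp
  simp only [Function.comp_apply]
  rw [e1, e2, mul_div_mul_right _ _ (by positivity)]

open Filter Topology in
lemma tendsto_div_sq_add_sq {s : ℝ} {l : Filter ℝ}
    (h0 : Tendsto (fun x : ℝ => x⁻¹) l (𝓝 0)) (hne : ∀ᶠ x in l, x ≠ 0) :
    Tendsto (fun x : ℝ => x / (s ^ 2 + x ^ 2)) l (𝓝 0) := by
  have hc : ContinuousAt (fun t : ℝ => t / (s ^ 2 * t ^ 2 + 1)) 0 :=
    ContinuousAt.div (by fun_prop) (by fun_prop) (by norm_num)
  have h := hc.tendsto.comp h0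
  simp only [zero_div] at h
  refine h.congr' ?_
  filter_upwards [hne] with x hx
  have e1 : s ^ 2 * x⁻¹ ^ 2 + 1 = (s ^ 2 + x ^ 2) * (x⁻¹) ^ 2 := by field_simp
  simp only [Function.comp_apply]
  rw [e1]
  field_simp

lemma integrable_inv_sq_add_sq {s : ℝ} (hs : 0 < s) :
    Integrable (fun x : ℝ => (s ^ 2 + x ^ 2)⁻¹) := by
  have h := (integrable_inv_one_add_sq.comp_div hs.ne').const_mul ((s ^ 2)⁻¹)
  refine h.congr (Filter.Eventually.of_forall fun x => ?_)
  have : 0 < s ^ 2 + x ^ 2 := by positivity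
  simp only
  rw [← mul_inv]
  congr 1
  field_simp

lemma abs_mul_div_sq_add_sq_le {s : ℝ} (hs : 0 < s) (x y : ℝ) :
    |x * y / ((s ^ 2 + x ^ 2) * (s ^ 2 + y ^ 2))| ≤ (s ^ 2 + x ^ 2)⁻¹ + (s ^ 2 + y ^ 2)⁻¹ := by
  have hx : 0 < s ^ 2 + x ^ 2 := by positivity
  have hy : 0 < s ^ 2 + y ^ 2 := by positivity
  have e : (s ^ 2 + x ^ 2)⁻¹ + (s ^ 2 + y ^ 2)⁻¹ =
      ((s ^ 2 + y ^ 2) + (s ^ 2 + x ^ 2)) / ((s ^ 2 + x ^ 2) * (s ^ 2 + y ^ 2)) := by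
    field_simp
  rw [abs_div, abs_of_pos (mul_pos hx hy), e]
  gcongr
  rw [abs_le]
  constructor <;> nlinarith [sq_nonneg (x - y), sq_nonneg (x + y), sq_nonneg s]

lemma integrable_bubble {s : ℝ} (hs : 0 < s) (b : ℝ) :
    Integrable (fun x : ℝ => x * (x - b) / ((s ^ 2 + x ^ 2) * (s ^ 2 + (x - b) ^ 2))) := by
  have hP := integrable_inv_sq_add_sq hs
  refine (hP.add (hP.comp_sub_right b)).mono' ?_ (Filter.Eventually.of_forall fun x => ?_)
  · refine (Continuous.div (by fun_prop) (by fun_prop) fun x => ?_).aestronglyMeasurable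
    positivity
  · exact abs_mul_div_sq_add_sq_le hs x (x - b)

lemma hasDerivAt_arctan_div {s : ℝ} (hs : 0 < s) (b x : ℝ) :
    HasDerivAt (fun x : ℝ => Real.arctan ((x - b) / s)) (s / (s ^ 2 + (x - b) ^ 2)) x := by
  have h := (((hasDerivAt_id x).sub_const b).div_const s).arctan
  have : 0 < s ^ 2 + (x - b) ^ 2 := by positivity
  refine h.congr_deriv ?_
  simp only [id_eq]
  field_simp

lemma hasDerivAt_bubble_primitive {s b : ℝ} (hs : 0 < s) (hb : b ≠ 0) (x : ℝ) :
    HasDerivAt (fun x : ℝ =>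
      -(2 * s ^ 2 + b ^ 2) / (2 * b * (b ^ 2 + 4 * s ^ 2)) *
          Real.log ((s ^ 2 + x ^ 2) / (s ^ 2 + (x - b) ^ 2)) +
        s / (b ^ 2 + 4 * s ^ 2) * (Real.arctan ((x - 0) / s) + Real.arctan ((x - b) / s)) -
        (1 / (2 * s) * Real.arctan ((x - 0) / s) - 1 / 2 * (x / (s ^ 2 + x ^ 2))))
      (x * (x - b) / ((s ^ 2 + x ^ 2) * (s ^ 2 + (x - b) ^ 2)) -
        x ^ 2 / (s ^ 2 + x ^ 2) ^ 2) x := by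
  have hP : 0 < s ^ 2 + x ^ 2 := by positivity
  have hQ : 0 < s ^ 2 + (x - b) ^ 2 := by positivity
  have hD : 0 < b ^ 2 + 4 * s ^ 2 := by positivity
  have h1 : HasDerivAt (fun x : ℝ => s ^ 2 + x ^ 2) (2 * x) x := by
    simpa using (hasDerivAt_pow 2 x).const_add (s ^ 2)
  have h2 : HasDerivAt (fun x : ℝ => s ^ 2 + (x - b) ^ 2) (2 * (x - b)) x := by
    simpa using (((hasDerivAt_id x).sub_const b).pow 2).const_add (s ^ 2)
  have hlog := (h1.div h2 hQ.ne').log (div_pos hP hQ).ne'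
  have hdiv := (hasDerivAt_id x).div h1 hP.ne'
  have hA := hasDerivAt_arctan_div hs 0 x
  have hB := hasDerivAt_arctan_div hs b x
  refine (((hlog.const_mul _).add ((hA.add hB).const_mul _)).sub
    ((hA.const_mul _).sub (hdiv.const_mul _))).congr_deriv ?_
  simp only [id, sub_zero, Pi.div_apply]
  field_simp
  ring

open Filter Topology in
lemma integral_bubble {s : ℝ} (hs : 0 < s) (b : ℝ) :
    ∫ x : ℝ, (x * (x - b) / ((s ^ 2 + x ^ 2) * (s ^ 2 + (x - b) ^ 2)) -
        x ^ 2 / (s ^ 2 + x ^ 2) ^ 2) =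
      -(Real.pi * b ^ 2) / (2 * s * (b ^ 2 + 4 * s ^ 2)) := by
  rcases eq_or_ne b 0 with rfl | hb
  · simp [← sq]
  have hint : Integrable (fun x : ℝ =>
      x * (x - b) / ((s ^ 2 + x ^ 2) * (s ^ 2 + (x - b) ^ 2)) -
        x ^ 2 / (s ^ 2 + x ^ 2) ^ 2) := by
    refine (integrable_bubble hs b).sub ?_
    simpa [← sq] using integrable_bubble hs 0
  have htop (c : ℝ) : Tendsto (fun x : ℝ => Real.arctan ((x - c) / s)) atTop
      (𝓝 (Real.pi / 2)) :=
    (tendsto_nhds_of_tendsto_nhdsWithin Real.tendsto_arctan_atTop).comp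
      ((tendsto_atTop_add_const_right _ (-c) tendsto_id).atTop_div_const hs)
  have hbot (c : ℝ) : Tendsto (fun x : ℝ => Real.arctan ((x - c) / s)) atBot
      (𝓝 (-(Real.pi / 2))) :=
    (tendsto_nhds_of_tendsto_nhdsWithin Real.tendsto_arctan_atBot).comp
      ((tendsto_atBot_add_const_right _ (-c) tendsto_id).atBot_div_const hs)
  have hlim {l : Filter ℝ} {c : ℝ} (h0 : Tendsto (fun x : ℝ => x⁻¹) l (𝓝 0))
      (hne : ∀ᶠ x in l, x ≠ 0)
      (h : ∀ d, Tendsto (fun x : ℝ => Real.arctan ((x - d) / s)) l (𝓝 c)) :=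
    (((tendsto_log_quadratic_ratio (s := s) b h0 hne).const_mul
        (-(2 * s ^ 2 + b ^ 2) / (2 * b * (b ^ 2 + 4 * s ^ 2)))).add
      (((h 0).add (h b)).const_mul (s / (b ^ 2 + 4 * s ^ 2)))).sub
      (((h 0).const_mul (1 / (2 * s))).sub
        ((tendsto_div_sq_add_sq (s := s) h0 hne).const_mul (1 / 2)))
  rw [integral_of_hasDerivAt_of_tendsto (hasDerivAt_bubble_primitive hs hb) hint
    (hlim tendsto_inv_atBot_zero (eventually_ne_atBot 0) hbot)
    (hlim tendsto_inv_atTop_zero (eventually_ne_atTop 0) htop)]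
  have hD : 0 < b ^ 2 + 4 * s ^ 2 := by positivity
  field_simp
  ring

/-- **Residue evaluation of the relativistic current-current bubble.**
For `a = ω² + k₁² > 0`, the `k₂`-integral of the difference of the two rational
functions equals `− v²p² / (4√a (v²p² + 4a))`, after division by `2π`. -/
theorem relativistic_bubble_integral (v p ω k₁ : ℝ) (hv : 0 < v)
    (ha : 0 < ω ^ 2 + k₁ ^ 2) :
    (1 / (2 * Real.pi)) *
        ∫ k₂ : ℝ,
          (k₂ * (k₂ - v * p) /
              (((ω ^ 2 + k₁ ^ 2) + k₂ ^ 2) * ((ω ^ 2 + k₁ ^ 2) + (k₂ - v * p) ^ 2)) -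
            k₂ ^ 2 / ((ω ^ 2 + k₁ ^ 2) + k₂ ^ 2) ^ 2) =
      -(v ^ 2 * p ^ 2) /
        (4 * Real.sqrt (ω ^ 2 + k₁ ^ 2) * (v ^ 2 * p ^ 2 + 4 * (ω ^ 2 + k₁ ^ 2))) := by
  set a := ω ^ 2 + k₁ ^ 2
  have hs : 0 < √a := Real.sqrt_pos.mpr ha
  have h := integral_bubble hs (v * p)
  have hD : 0 < v ^ 2 * p ^ 2 + 4 * a := by positivity
  rw [Real.sq_sqrt ha.le, mul_pow] at h
  rw [h]
  have := Real.pi_pos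
  field_simp
  ring
end

section
/- With f(x,y) := 1 + (1/2)·cos x + (1/2)·cos y (which is strictly positive on [−π,π]² except at the four corners (±π,±π)), both of the following Lebesgue integrals over [−π,π]² are finite and: ∫_{[−π,π]²} sin²(x) · f(x,y)^{−3/2} d(x,y) = −4 · ∫_{[−π,π]²} cos(x) · f(x,y)^{−1/2} d(x,y). -/
open MeasureTheory

/-- The function `(π - |x|) ^ (-1/2)` is dominated by this one, which is integrable on `(-π, π)`. -/
noncomputable def endpointMajorant (x : ℝ) : ℝ :=
  (Real.pi - x) ^ (-(1 : ℝ) / 2) + (Real.pi + x) ^ (-(1 : ℝ) / 2)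

theorem integrableOn_endpointMajorant :
    IntegrableOn endpointMajorant (Set.Ioo (-Real.pi) Real.pi) volume := by
  have hpi := Real.pi_pos
  have h0 : ∀ a b : ℝ, IntervalIntegrable (fun x : ℝ => x ^ (-(1 : ℝ) / 2)) volume a b :=
    fun a b => intervalIntegral.intervalIntegrable_rpow' (by norm_num)
  have h1 : IntervalIntegrable (fun x : ℝ => (Real.pi - x) ^ (-(1 : ℝ) / 2)) volume
      (-Real.pi) Real.pi := by
    have := (h0 (2 * Real.pi) 0).comp_sub_left Real.pi
    convert this using 1 <;> ring
  have h2 : IntervalIntegrable (fun x : ℝ => (Real.pi + x) ^ (-(1 : ℝ) / 2)) volume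
      (-Real.pi) Real.pi := by
    have := (h0 0 (2 * Real.pi)).comp_add_left Real.pi
    convert this using 1 <;> ring
  have h3 := (h1.add h2).1
  exact h3.mono_set Set.Ioo_subset_Ioc_self

theorem rpow_pi_sub_abs_le_endpointMajorant {x : ℝ} (hx : x ∈ Set.Ioo (-Real.pi) Real.pi) :
    (Real.pi - |x|) ^ (-(1 : ℝ) / 2) ≤ endpointMajorant x := by
  obtain ⟨h1, h2⟩ := hx
  have h3 : 0 ≤ (Real.pi - x) ^ (-(1 : ℝ) / 2) := Real.rpow_nonneg (by linarith) _
  have h4 : 0 ≤ (Real.pi + x) ^ (-(1 : ℝ) / 2) := Real.rpow_nonneg (by linarith) _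
  unfold endpointMajorant
  rcases abs_cases x with ⟨h, _⟩ | ⟨h, _⟩ <;> rw [h]
  · linarith
  · rw [sub_neg_eq_add]; linarith

theorem pi_sub_abs_le_four_mul_cos_half {x : ℝ} (hx : x ∈ Set.Ioo (-Real.pi) Real.pi) :
    Real.pi - |x| ≤ 4 * Real.cos (x / 2) := by
  have hpi := Real.pi_pos
  have habs : |x| < Real.pi := abs_lt.2 hx
  have h := Real.one_sub_mul_le_cos (x := |x| / 2) (by positivity) (by linarith)
  have h2 : Real.cos (|x| / 2) = Real.cos (x / 2) := by
    rw [← Real.cos_abs (x / 2), abs_div, abs_two]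
  rw [h2] at h
  have h3 : 1 - 2 / Real.pi * (|x| / 2) = (Real.pi - |x|) / Real.pi := by field_simp
  rw [h3, div_le_iff₀ hpi] at h
  have h4 : 0 ≤ Real.cos (x / 2) :=
    Real.cos_nonneg_of_mem_Icc ⟨by linarith [hx.1], by linarith [hx.2]⟩
  nlinarith [Real.pi_le_four]

theorem mul_pi_sub_abs_le {x y : ℝ} (hx : x ∈ Set.Ioo (-Real.pi) Real.pi)
    (hy : y ∈ Set.Ioo (-Real.pi) Real.pi) :
    (Real.pi - |x|) * (Real.pi - |y|) / 8 ≤ 1 + Real.cos x / 2 + Real.cos y / 2 := by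
  have hx' : 0 < Real.pi - |x| := sub_pos.2 (abs_lt.2 hx)
  have hy' : 0 < Real.pi - |y| := sub_pos.2 (abs_lt.2 hy)
  have h1 := pi_sub_abs_le_four_mul_cos_half hx
  have h2 := pi_sub_abs_le_four_mul_cos_half hy
  have h3 := mul_le_mul h1 h2 hy'.le (by linarith)
  have h4 := Real.cos_sq (x / 2)
  have h5 := Real.cos_sq (y / 2)
  rw [mul_div_cancel₀ _ two_ne_zero] at h4 h5
  nlinarith [sq_nonneg (Real.cos (x / 2) - Real.cos (y / 2))]

theorem one_add_half_cos_pos {y : ℝ} (x : ℝ) (hy : y ∈ Set.Ioo (-Real.pi) Real.pi) :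
    0 < 1 + Real.cos x / 2 + Real.cos y / 2 := by
  have h : 0 < Real.cos (y / 2) :=
    Real.cos_pos_of_mem_Ioo ⟨by linarith [hy.1], by linarith [hy.2]⟩
  have h5 := Real.cos_sq (y / 2)
  rw [mul_div_cancel₀ _ two_ne_zero] at h5
  nlinarith [Real.neg_one_le_cos x, pow_pos h 2]

theorem rpow_neg_half_le {x y : ℝ} (hx : x ∈ Set.Ioo (-Real.pi) Real.pi)
    (hy : y ∈ Set.Ioo (-Real.pi) Real.pi) :
    (1 + Real.cos x / 2 + Real.cos y / 2) ^ (-(1 : ℝ) / 2) ≤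
      (1 / 8 : ℝ) ^ (-(1 : ℝ) / 2) * (endpointMajorant x * endpointMajorant y) := by
  have hx' : 0 < Real.pi - |x| := sub_pos.2 (abs_lt.2 hx)
  have hy' : 0 < Real.pi - |y| := sub_pos.2 (abs_lt.2 hy)
  have hx0 := Real.rpow_nonneg hx'.le (-(1 : ℝ) / 2)
  have hy0 := Real.rpow_nonneg hy'.le (-(1 : ℝ) / 2)
  calc (1 + Real.cos x / 2 + Real.cos y / 2) ^ (-(1 : ℝ) / 2)
      ≤ (1 / 8 * ((Real.pi - |x|) * (Real.pi - |y|))) ^ (-(1 : ℝ) / 2) :=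
        Real.rpow_le_rpow_of_nonpos (by positivity)
          (by linarith [mul_pi_sub_abs_le hx hy]) (by norm_num)
    _ = (1 / 8 : ℝ) ^ (-(1 : ℝ) / 2) *
          ((Real.pi - |x|) ^ (-(1 : ℝ) / 2) * (Real.pi - |y|) ^ (-(1 : ℝ) / 2)) := by
        rw [Real.mul_rpow (by norm_num) (by positivity), Real.mul_rpow hx'.le hy'.le]
    _ ≤ _ := by
        have hxm := rpow_pi_sub_abs_le_endpointMajorant hx
        have hym := rpow_pi_sub_abs_le_endpointMajorant hy
        exact mul_le_mul_of_nonneg_left (mul_le_mul hxm hym hy0 (hx0.trans hxm))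
          (Real.rpow_nonneg (by norm_num) _)

theorem sin_sq_mul_rpow_le (x : ℝ) {y : ℝ} (hy : y ∈ Set.Ioo (-Real.pi) Real.pi) :
    Real.sin x ^ 2 * (1 + Real.cos x / 2 + Real.cos y / 2) ^ (-(3 : ℝ) / 2) ≤
      4 * (1 + Real.cos x / 2 + Real.cos y / 2) ^ (-(1 : ℝ) / 2) := by
  have hf := one_add_half_cos_pos x hy
  have h1 : (1 + Real.cos x / 2 + Real.cos y / 2) ^ (-(1 : ℝ) / 2) =
      (1 + Real.cos x / 2 + Real.cos y / 2) ^ (-(3 : ℝ) / 2) *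
        (1 + Real.cos x / 2 + Real.cos y / 2) := by
    rw [← Real.rpow_add_one hf.ne']; norm_num
  have h2 : Real.sin x ^ 2 ≤ 4 * (1 + Real.cos x / 2 + Real.cos y / 2) := by
    nlinarith [Real.sin_sq_add_cos_sq x, Real.neg_one_le_cos x, Real.neg_one_le_cos y,
      sq_nonneg (Real.cos x + 1)]
  rw [h1]
  nlinarith [mul_le_mul_of_nonneg_right h2 (Real.rpow_nonneg hf.le (-(3 : ℝ) / 2))]

theorem integral_sin_sq_mul_rpow {y : ℝ} (hy : y ∈ Set.Ioo (-Real.pi) Real.pi) :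
    ∫ x in Set.Ioo (-Real.pi) Real.pi,
        Real.sin x ^ 2 * (1 + Real.cos x / 2 + Real.cos y / 2) ^ (-(3 : ℝ) / 2) =
      -4 * ∫ x in Set.Ioo (-Real.pi) Real.pi,
        Real.cos x * (1 + Real.cos x / 2 + Real.cos y / 2) ^ (-(1 : ℝ) / 2) := by
  have hpi : -Real.pi ≤ Real.pi := by linarith [Real.pi_pos]
  have hne : ∀ x, 1 + Real.cos x / 2 + Real.cos y / 2 ≠ 0 :=
    fun x => (one_add_half_cos_pos x hy).ne'
  have hcont : ∀ r : ℝ, Continuous fun x => (1 + Real.cos x / 2 + Real.cos y / 2) ^ r :=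
    fun r => Continuous.rpow_const (by fun_prop) fun x => Or.inl (hne x)
  have hs : Continuous fun x =>
      Real.sin x ^ 2 * (1 + Real.cos x / 2 + Real.cos y / 2) ^ (-(3 : ℝ) / 2) :=
    (Real.continuous_sin.pow 2).mul (hcont _)
  have hc : Continuous fun x =>
      Real.cos x * (1 + Real.cos x / 2 + Real.cos y / 2) ^ (-(1 : ℝ) / 2) :=
    Real.continuous_cos.mul (hcont _)
  have hs4 : Continuous fun x =>
      1 / 4 * (Real.sin x ^ 2 * (1 + Real.cos x / 2 + Real.cos y / 2) ^ (-(3 : ℝ) / 2)) :=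
    continuous_const.mul hs
  have hderiv : ∀ x, HasDerivAt
      (fun x => Real.sin x * (1 + Real.cos x / 2 + Real.cos y / 2) ^ (-(1 : ℝ) / 2))
      (Real.cos x * (1 + Real.cos x / 2 + Real.cos y / 2) ^ (-(1 : ℝ) / 2) +
        1 / 4 * (Real.sin x ^ 2 * (1 + Real.cos x / 2 + Real.cos y / 2) ^ (-(3 : ℝ) / 2))) x := by
    intro x
    have h1 : HasDerivAt (fun x => 1 + Real.cos x / 2 + Real.cos y / 2) (-Real.sin x / 2) x :=
      (((Real.hasDerivAt_cos x).div_const 2).const_add 1).add_const _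
    have h2 := (Real.hasDerivAt_sin x).mul
      (h1.rpow_const (p := -(1 : ℝ) / 2) (Or.inl (hne x)))
    refine h2.congr_deriv ?_
    rw [show -(1 : ℝ) / 2 - 1 = -(3 : ℝ) / 2 by norm_num]
    ring
  have key := intervalIntegral.integral_eq_sub_of_hasDerivAt (a := -Real.pi) (b := Real.pi)
    (fun x _ => hderiv x) ((hc.add hs4).intervalIntegrable _ _)
  rw [intervalIntegral.integral_add (hc.intervalIntegrable _ _)
    (hs4.intervalIntegrable _ _),
    intervalIntegral.integral_const_mul, Real.sin_neg, Real.sin_pi] at key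
  rw [← integral_Ioc_eq_integral_Ioo, ← integral_Ioc_eq_integral_Ioo,
    ← intervalIntegral.integral_of_le hpi, ← intervalIntegral.integral_of_le hpi]
  linarith

theorem volume_restrict_square :
    (volume : Measure (ℝ × ℝ)).restrict
        (Set.Icc (-Real.pi) Real.pi ×ˢ Set.Icc (-Real.pi) Real.pi) =
      (volume.restrict (Set.Ioo (-Real.pi) Real.pi)).prod
        (volume.restrict (Set.Ioo (-Real.pi) Real.pi)) := by
  rw [Measure.volume_eq_prod, ← Measure.prod_restrict,
    Measure.restrict_congr_set (Ioo_ae_eq_Icc (μ := volume) (a := -Real.pi) (b := Real.pi))]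

/-- **Exact cancellation of the two second-order terms.**  With
`f(x,y) = 1 + cos x / 2 + cos y / 2`, both integrals over `[−π,π]²` are finite and
`∫ sin²x · f^{−3/2} = −4 ∫ cos x · f^{−1/2}` (the negative-power expressions are
interpreted via `Real.rpow`, which vanishes at the zero set of `f`, a set of
measure zero consisting of the four corners). -/
theorem second_order_cancellation :
    let f : ℝ → ℝ → ℝ := fun x y => 1 + Real.cos x / 2 + Real.cos y / 2
    let S : Set (ℝ × ℝ) := Set.Icc (-Real.pi) Real.pi ×ˢ Set.Icc (-Real.pi) Real.pi
    IntegrableOn (fun p : ℝ × ℝ => Real.sin p.1 ^ 2 * f p.1 p.2 ^ (-(3 : ℝ) / 2)) S volume ∧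
      IntegrableOn (fun p : ℝ × ℝ => Real.cos p.1 * f p.1 p.2 ^ (-(1 : ℝ) / 2)) S volume ∧
      (∫ p in S, Real.sin p.1 ^ 2 * f p.1 p.2 ^ (-(3 : ℝ) / 2)) =
        -4 * ∫ p in S, Real.cos p.1 * f p.1 p.2 ^ (-(1 : ℝ) / 2) := by
  intro f S
  simp only [f, S, IntegrableOn, volume_restrict_square]
  set μ := (volume : Measure ℝ).restrict (Set.Ioo (-Real.pi) Real.pi) with hμ
  have hmem : ∀ᵐ p ∂μ.prod μ, p ∈ Set.Ioo (-Real.pi) Real.pi ×ˢ Set.Ioo (-Real.pi) Real.pi := by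
    rw [hμ, Measure.prod_restrict]
    exact ae_restrict_mem (measurableSet_Ioo.prod measurableSet_Ioo)
  have hM : Integrable (fun p : ℝ × ℝ => (1 / 8 : ℝ) ^ (-(1 : ℝ) / 2) *
      (endpointMajorant p.1 * endpointMajorant p.2)) (μ.prod μ) :=
    (Integrable.mul_prod integrableOn_endpointMajorant integrableOn_endpointMajorant).const_mul _
  have hs : Integrable (fun p : ℝ × ℝ => Real.sin p.1 ^ 2 *
      (1 + Real.cos p.1 / 2 + Real.cos p.2 / 2) ^ (-(3 : ℝ) / 2)) (μ.prod μ) := by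
    refine (hM.const_mul 4).mono' (by fun_prop) ?_
    filter_upwards [hmem] with p hp
    have hf := one_add_half_cos_pos p.1 hp.2
    rw [Real.norm_of_nonneg (mul_nonneg (sq_nonneg _) (Real.rpow_nonneg hf.le _))]
    linarith [sin_sq_mul_rpow_le p.1 hp.2, rpow_neg_half_le hp.1 hp.2]
  have hc : Integrable (fun p : ℝ × ℝ => Real.cos p.1 *
      (1 + Real.cos p.1 / 2 + Real.cos p.2 / 2) ^ (-(1 : ℝ) / 2)) (μ.prod μ) := by
    refine hM.mono' (by fun_prop) ?_
    filter_upwards [hmem] with p hp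
    have hf := Real.rpow_nonneg (one_add_half_cos_pos p.1 hp.2).le (-(1 : ℝ) / 2)
    rw [norm_mul, Real.norm_of_nonneg hf, Real.norm_eq_abs]
    exact (mul_le_of_le_one_left hf (Real.abs_cos_le_one _)).trans
      (rpow_neg_half_le hp.1 hp.2)
  refine ⟨hs, hc, ?_⟩
  rw [integral_prod_symm _ hs, integral_prod_symm _ hc, ← integral_const_mul]
  exact setIntegral_congr_fun measurableSet_Ioo fun y hy => integral_sin_sq_mul_rpow hy
end

section
/- Let n ∈ ℕ, β ∈ ℝ, ε : {1,…,n} → ℝ, and let B ⊆ {1,…,n} be a subset. Let S := { i ∈ {1,…,n} : ε(i) = 0 } be the set of zero modes. If |B| < |S|, then Σ_{q : {1,…,n} → {0,1}} (−1)^{Σ_{i=1}^{n} q(i)} · e^{−β·Σ_{i=1}^{n} ε(i)·q(i)} · ∏_{i ∈ B} q(i) = 0. -/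
/-- **Vanishing of the parity-weighted trace in the presence of zero modes.**
The sum over occupation-number configurations `q ∈ {0,1}^n` (encoded as
`q : Fin n → Bool`) of `(−1)^{Σ q(i)} e^{−β Σ ε(i) q(i)} ∏_{i∈B} q(i)` vanishes
whenever `|B|` is strictly smaller than the number of zero modes of `ε`. -/
theorem parity_weighted_trace_vanishes (n : ℕ) (β : ℝ) (ε : Fin n → ℝ)
    (B : Finset (Fin n)) (hB : B.card < Set.ncard {i : Fin n | ε i = 0}) :
    ∑ q : Fin n → Bool,
        ((-1 : ℝ) ^ (∑ i : Fin n, if q i then (1 : ℕ) else 0) *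
          Real.exp (-β * ∑ i : Fin n, ε i * (if q i then (1 : ℝ) else 0)) *
          ∏ i ∈ B, (if q i then (1 : ℝ) else 0)) = 0 := by
  obtain ⟨j, hj, hjB⟩ : ∃ j ∈ {i : Fin n | ε i = 0}, j ∉ (B : Set (Fin n)) :=
    Set.exists_mem_notMem_of_ncard_lt_ncard (by rwa [Set.ncard_coe_finset])
  let f : Fin n → Bool → ℝ := fun i b =>
    (-1 : ℝ) ^ (if b then (1 : ℕ) else 0) *
      Real.exp (-β * (ε i * (if b then (1 : ℝ) else 0))) *
      (if i ∈ B then (if b then (1 : ℝ) else 0) else 1)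
  have hfactor : ∀ q : Fin n → Bool,
      (-1 : ℝ) ^ (∑ i : Fin n, if q i then (1 : ℕ) else 0) *
          Real.exp (-β * ∑ i : Fin n, ε i * (if q i then (1 : ℝ) else 0)) *
          ∏ i ∈ B, (if q i then (1 : ℝ) else 0) = ∏ i, f i (q i) := by
    intro q
    simp only [f, Finset.prod_mul_distrib]
    rw [Finset.prod_pow_eq_pow_sum, Finset.mul_sum, Real.exp_sum, Fintype.prod_ite_mem]
  rw [Finset.sum_congr rfl fun q _ => hfactor q, ← Fintype.prod_sum]
  refine Finset.prod_eq_zero (Finset.mem_univ j) ?_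
  have hj0 : ε j = 0 := hj
  have hjB' : j ∉ B := hjB
  simp [f, hj0, hjB']
end

section
/- Let t > 0. For ℓ ≥ 1 set L = 4ℓ and define: E_π(L) := Σ_{k ∈ B_L(−1,−1)} e₋(k); and E_*(L) := Σ_{k ∈ B̃_L} 2·(e₁₋(k) + e₂₋(k)), where B̃_L := { ((2π/L)·n₁, (2π/L)·n₂) : n₁ ∈ {0,…,L/4−1}, n₂ ∈ {0,…,L/2−1} }, e₁₋(k) := −2t·√(1 + (1/2)·√(1 + cos²(2k₁) + cos²(2k₂))) and e₂₋(k) := −2t·√(1 − (1/2)·√(1 + cos²(2k₁) + cos²(2k₂))). Then lim_{ℓ→∞} (1/L²)·(E_*(L) − E_π(L)) = (t/(4π²))·∫₀^{2π}∫₀^{2π} √(1 + (1/2)·cos k₁ + (1/2)·cos k₂) dk₁ dk₂ − (t/(8π²))·∫₀^{2π}∫₀^{2π} √(1 + (1/2)·√(1 + cos² k₁ + cos² k₂)) dk₁ dk₂ − (t/(8π²))·∫₀^{2π}∫₀^{2π} √(1 − (1/2)·√(1 + cos² k₁ + cos² k₂)) dk₁ dk₂. -/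
open MeasureTheory

/-- The Riemann sum of `f` over `N` cells of length `h`, sampled at relative position `s` in each
cell, is within `ε * (h * N)` of the integral if `f` oscillates by at most `ε` at scale `h`. -/
theorem abs_riemannSum_sub_integral_le {f : ℝ → ℝ} (hf : Continuous f) {h s ε : ℝ} (hh : 0 ≤ h)
    (hs0 : 0 ≤ s) (hs1 : s ≤ 1) (N : ℕ)
    (H : ∀ x ∈ Set.Icc 0 (h * N), ∀ y ∈ Set.Icc 0 (h * N), |x - y| ≤ h → |f x - f y| ≤ ε) :
    |h * ∑ n ∈ Finset.range N, f (h * (n + s)) - ∫ x in (0 : ℝ)..h * N, f x| ≤ ε * (h * N) := by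
  have hsum := intervalIntegral.sum_integral_adjacent_intervals (μ := volume) (f := f)
    (a := fun n : ℕ => h * (n : ℝ)) (n := N) (fun k _ => hf.intervalIntegrable _ _)
  simp only [Nat.cast_zero, mul_zero] at hsum
  rw [← hsum, Finset.mul_sum, ← Finset.sum_sub_distrib]
  refine (Finset.abs_sum_le_sum_abs _ _).trans ?_
  have hcell : ∀ n ∈ Finset.range N,
      |h * f (h * (n + s)) - ∫ x in h * (n : ℝ)..h * ((n + 1 : ℕ) : ℝ), f x| ≤ ε * h := by
    intro n hn
    have hnN : (n : ℝ) + 1 ≤ N := by exact_mod_cast Finset.mem_range.mp hn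
    have hn0 : (0 : ℝ) ≤ n := n.cast_nonneg
    have hend : h * ((n + 1 : ℕ) : ℝ) = h * n + h := by push_cast; ring
    have hconst : h * f (h * (n + s)) =
        ∫ _ in h * (n : ℝ)..h * ((n + 1 : ℕ) : ℝ), f (h * (n + s)) := by
      rw [intervalIntegral.integral_const, hend, smul_eq_mul]; ring
    rw [hconst, ← intervalIntegral.integral_sub (by simp) (hf.intervalIntegrable _ _)]
    have hsh : h * s ≤ h := mul_le_of_le_one_right hh hs1
    have hsh0 : 0 ≤ h * s := mul_nonneg hh hs0
    have hnh : 0 ≤ h * n := mul_nonneg hh hn0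
    have hNh : h * n + h ≤ h * N := by nlinarith
    have hb := intervalIntegral.norm_integral_le_of_norm_le_const
      (a := h * (n : ℝ)) (b := h * ((n + 1 : ℕ) : ℝ)) (C := ε)
      (f := fun x => f (h * (n + s)) - f x) ?_
    · rwa [hend, add_sub_cancel_left, abs_of_nonneg hh, Real.norm_eq_abs, ← hend] at hb
    · intro x hx
      rw [hend, Set.uIoc_of_le (by linarith)] at hx
      obtain ⟨hx1, hx2⟩ := hx
      refine H _ ⟨?_, ?_⟩ _ ⟨?_, ?_⟩ ?_
      · rw [mul_add]; linarith
      · rw [mul_add]; linarith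
      · linarith
      · linarith
      · rw [mul_add, abs_le]; constructor <;> linarith
  refine (Finset.sum_le_sum hcell).trans (le_of_eq ?_)
  rw [Finset.sum_const, Finset.card_range, nsmul_eq_mul]; ring

/-- Two-dimensional Riemann sums of a continuous function with mesh `c / ℓ` over the rectangle
`[0, c * a] × [0, c * b]` converge to the iterated integral. -/
theorem tendsto_riemannSum_rectangle {F : ℝ → ℝ → ℝ} (hF : Continuous (Function.uncurry F))
    {c s : ℝ} (hc : 0 ≤ c) (hs0 : 0 ≤ s) (hs1 : s ≤ 1) (a b : ℕ) :
    Filter.Tendsto (fun ℓ : ℕ => (c / ℓ) ^ 2 *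
        ∑ n₁ ∈ Finset.range (a * ℓ), ∑ n₂ ∈ Finset.range (b * ℓ),
          F (c / ℓ * (n₁ + s)) (c / ℓ * (n₂ + s)))
      Filter.atTop
      (nhds (∫ x in (0 : ℝ)..c * a, ∫ y in (0 : ℝ)..c * b, F x y)) := by
  set A := c * a with hA
  set B := c * b with hB
  have hA0 : 0 ≤ A := by positivity
  have hB0 : 0 ≤ B := by positivity
  have huc : UniformContinuousOn (Function.uncurry F) (Set.Icc 0 A ×ˢ Set.Icc 0 B) :=
    (isCompact_Icc.prod isCompact_Icc).uniformContinuousOn_of_continuous hF.continuousOn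
  rw [Metric.tendsto_atTop]
  intro ε hε
  set η := ε / (2 * (A * B + 1)) with hη
  have hη0 : 0 < η := by positivity
  obtain ⟨δ, hδ, Hδ⟩ := Metric.uniformContinuousOn_iff.mp huc η hη0
  have hlim : Filter.Tendsto (fun ℓ : ℕ => c / (ℓ : ℝ)) Filter.atTop (nhds 0) :=
    tendsto_const_div_atTop_nhds_zero_nat c
  obtain ⟨M, hM⟩ := Filter.eventually_atTop.mp
    ((hlim.eventually (gt_mem_nhds hδ)).and (Filter.eventually_gt_atTop 0))
  refine ⟨M, fun ℓ hℓ => ?_⟩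
  obtain ⟨hhδ, hℓ0⟩ := hM ℓ hℓ
  have hℓ' : (ℓ : ℝ) ≠ 0 := by positivity
  set h := c / (ℓ : ℝ) with hh
  have hh0 : 0 ≤ h := by positivity
  have hhA : h * ((a * ℓ : ℕ) : ℝ) = A := by rw [hh, hA]; push_cast; field_simp
  have hhB : h * ((b * ℓ : ℕ) : ℝ) = B := by rw [hh, hB]; push_cast; field_simp
  have hcont : ∀ x, Continuous (F x) := fun x => hF.comp (Continuous.prodMk_right x)
  have hG : Continuous fun x => ∫ y in (0 : ℝ)..B, F x y :=
    intervalIntegral.continuous_parametric_intervalIntegral_of_continuous' hF 0 B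
  have houter := abs_riemannSum_sub_integral_le hG hh0 hs0 hs1 (a * ℓ) (ε := η * B) (by
    rw [hhA]
    intro x hx x' hx' hxx'
    rw [← intervalIntegral.integral_sub ((hcont x).intervalIntegrable _ _)
      ((hcont x').intervalIntegrable _ _)]
    have hb := intervalIntegral.norm_integral_le_of_norm_le_const
      (a := 0) (b := B) (C := η) (f := fun y => F x y - F x' y) (by
        intro y hy
        rw [Set.uIoc_of_le hB0] at hy
        have hy' : y ∈ Set.Icc 0 B := ⟨hy.1.le, hy.2⟩
        have := Hδ (x, y) ⟨hx, hy'⟩ (x', y) ⟨hx', hy'⟩ (by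
          rw [Prod.dist_eq, dist_self, max_eq_left dist_nonneg, Real.dist_eq]
          exact hxx'.trans_lt hhδ)
        exact this.le)
    rwa [sub_zero, abs_of_nonneg hB0] at hb)
  have hinner : ∀ n ∈ Finset.range (a * ℓ),
      |h * ∑ n₂ ∈ Finset.range (b * ℓ), F (h * (n + s)) (h * (n₂ + s)) -
        ∫ y in (0 : ℝ)..B, F (h * (n + s)) y| ≤ η * B := by
    intro n hn
    have hn1 : (n : ℝ) + 1 ≤ (a * ℓ : ℕ) := by exact_mod_cast Finset.mem_range.mp hn
    have hx : h * (n + s) ∈ Set.Icc 0 A := by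
      refine ⟨by positivity, ?_⟩
      rw [← hhA]
      exact mul_le_mul_of_nonneg_left (by linarith) hh0
    have := abs_riemannSum_sub_integral_le (hcont (h * (n + s))) hh0 hs0 hs1 (b * ℓ) (ε := η) (by
      rw [hhB]
      intro y hy y' hy' hyy'
      have := Hδ (h * (n + s), y) ⟨hx, hy⟩ (h * (n + s), y') ⟨hx, hy'⟩ (by
        rw [Prod.dist_eq, dist_self, max_eq_right dist_nonneg, Real.dist_eq]
        exact hyy'.trans_lt hhδ)
      exact this.le)
    rwa [hhB] at this
  have hinnerSum : |h * ∑ n ∈ Finset.range (a * ℓ),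
      (h * ∑ n₂ ∈ Finset.range (b * ℓ), F (h * (n + s)) (h * (n₂ + s)) -
        ∫ y in (0 : ℝ)..B, F (h * (n + s)) y)| ≤ η * B * A := by
    rw [abs_mul, abs_of_nonneg hh0]
    calc _ ≤ h * ∑ _n ∈ Finset.range (a * ℓ), η * B :=
          mul_le_mul_of_nonneg_left
            ((Finset.abs_sum_le_sum_abs _ _).trans (Finset.sum_le_sum hinner)) hh0
      _ = η * B * A := by
          rw [Finset.sum_const, Finset.card_range, nsmul_eq_mul, ← hhA]; ring
  rw [hhA] at houter
  have hsplit : h ^ 2 * ∑ n₁ ∈ Finset.range (a * ℓ), ∑ n₂ ∈ Finset.range (b * ℓ),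
        F (h * (n₁ + s)) (h * (n₂ + s)) - (∫ x in (0 : ℝ)..A, ∫ y in (0 : ℝ)..B, F x y) =
      h * ∑ n ∈ Finset.range (a * ℓ),
        (h * ∑ n₂ ∈ Finset.range (b * ℓ), F (h * (n + s)) (h * (n₂ + s)) -
          ∫ y in (0 : ℝ)..B, F (h * (n + s)) y) +
      (h * ∑ n ∈ Finset.range (a * ℓ), (∫ y in (0 : ℝ)..B, F (h * (n + s)) y) -
        ∫ x in (0 : ℝ)..A, ∫ y in (0 : ℝ)..B, F x y) := by
    rw [Finset.sum_sub_distrib, ← Finset.mul_sum]; ring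
  rw [Real.dist_eq, hsplit]
  refine (abs_add_le _ _).trans_lt ((add_le_add hinnerSum houter).trans_lt ?_)
  have hε' : η * (2 * (A * B + 1)) = ε := by rw [hη]; field_simp
  linarith

/-- Over twice its period, a continuous periodic function integrates to twice its integral over
one period. -/
theorem Function.Periodic.integral_two_mul {f : ℝ → ℝ} {T : ℝ} (hp : Function.Periodic f T)
    (hf : Continuous f) :
    ∫ x in (0 : ℝ)..T * 2, f x = 2 * ∫ x in (0 : ℝ)..T, f x := by
  rw [← intervalIntegral.integral_add_adjacent_intervals (hf.intervalIntegrable 0 T)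
    (hf.intervalIntegrable T (T * 2))]
  have := hp.intervalIntegral_add_eq T 0
  rw [zero_add, ← mul_two] at this
  rw [this]; ring

/-- **Asymptotics of the monopole mass.**  With `L = 4ℓ`,
`E_π(L)` the half-filled ground state energy of the `(−1,−1)` π-flux phase and
`E_*(L)` that of the staggered (chessboard) flux configuration (doubly degenerate
bands `e₁₋`, `e₂₋`), the normalized difference `(E_*(L) − E_π(L))/L²` converges,
as `ℓ → ∞`, to the explicit integral expression for the monopole mass `Δ_∞`. -/
theorem monopole_mass_asymptotics (t : ℝ) (ht : 0 < t) :
    let Epi : ℕ → ℝ := fun L =>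
      ∑ n₁ ∈ Finset.range L, ∑ n₂ ∈ Finset.range (L / 2),
        -2 * t * Real.sqrt (1 +
          Real.cos (2 * (2 * Real.pi / L * ((n₁ : ℝ) + 1 / 2))) / 2 +
          Real.cos (2 * (2 * Real.pi / L * ((n₂ : ℝ) + 1 / 2))) / 2)
    let Estar : ℕ → ℝ := fun L =>
      ∑ n₁ ∈ Finset.range (L / 4), ∑ n₂ ∈ Finset.range (L / 2),
        2 * ((-2 * t * Real.sqrt (1 +
                Real.sqrt (1 + Real.cos (2 * (2 * Real.pi / L * (n₁ : ℝ))) ^ 2 +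
                  Real.cos (2 * (2 * Real.pi / L * (n₂ : ℝ))) ^ 2) / 2)) +
             (-2 * t * Real.sqrt (1 -
                Real.sqrt (1 + Real.cos (2 * (2 * Real.pi / L * (n₁ : ℝ))) ^ 2 +
                  Real.cos (2 * (2 * Real.pi / L * (n₂ : ℝ))) ^ 2) / 2)))
    Filter.Tendsto
      (fun ℓ : ℕ => (1 / ((4 * ℓ : ℝ)) ^ 2) * (Estar (4 * ℓ) - Epi (4 * ℓ)))
      Filter.atTop
      (nhds (t / (4 * Real.pi ^ 2) *
          (∫ k₁ in (0 : ℝ)..(2 * Real.pi), ∫ k₂ in (0 : ℝ)..(2 * Real.pi),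
            Real.sqrt (1 + Real.cos k₁ / 2 + Real.cos k₂ / 2)) -
        t / (8 * Real.pi ^ 2) *
          (∫ k₁ in (0 : ℝ)..(2 * Real.pi), ∫ k₂ in (0 : ℝ)..(2 * Real.pi),
            Real.sqrt (1 + Real.sqrt (1 + Real.cos k₁ ^ 2 + Real.cos k₂ ^ 2) / 2)) -
        t / (8 * Real.pi ^ 2) *
          (∫ k₁ in (0 : ℝ)..(2 * Real.pi), ∫ k₂ in (0 : ℝ)..(2 * Real.pi),
            Real.sqrt (1 - Real.sqrt (1 + Real.cos k₁ ^ 2 + Real.cos k₂ ^ 2) / 2)))) := by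
  intro Epi Estar
  have hpi := Real.pi_pos
  let F₀ : ℝ → ℝ → ℝ := fun x y => Real.sqrt (1 + Real.cos x / 2 + Real.cos y / 2)
  let F₁ : ℝ → ℝ → ℝ := fun x y =>
    Real.sqrt (1 + Real.sqrt (1 + Real.cos x ^ 2 + Real.cos y ^ 2) / 2)
  let F₂ : ℝ → ℝ → ℝ := fun x y =>
    Real.sqrt (1 - Real.sqrt (1 + Real.cos x ^ 2 + Real.cos y ^ 2) / 2)
  have hF₀ : Continuous (Function.uncurry F₀) := by
    simp only [F₀, Function.uncurry_def]; fun_prop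
  have hF₁ : Continuous (Function.uncurry F₁) := by
    simp only [F₁, Function.uncurry_def]; fun_prop
  have hF₂ : Continuous (Function.uncurry F₂) := by
    simp only [F₂, Function.uncurry_def]; fun_prop
  have hG {F : ℝ → ℝ → ℝ} (hF : Continuous (Function.uncurry F)) (B : ℝ) :
      Continuous fun x => ∫ y in (0 : ℝ)..B, F x y :=
    intervalIntegral.continuous_parametric_intervalIntegral_of_continuous' hF 0 B
  have T₀ := tendsto_riemannSum_rectangle hF₀ hpi.le (s := 1 / 2) (by norm_num) (by norm_num) 4 2
  have T₁ := tendsto_riemannSum_rectangle hF₁ hpi.le (s := 0) le_rfl zero_le_one 1 2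
  have T₂ := tendsto_riemannSum_rectangle hF₂ hpi.le (s := 0) le_rfl zero_le_one 1 2
  have P₀ : Function.Periodic (fun x => ∫ y in (0 : ℝ)..2 * Real.pi, F₀ x y) (2 * Real.pi) := by
    intro x; simp only [F₀, Real.cos_add_two_pi]
  have P₁ : Function.Periodic (fun x => ∫ y in (0 : ℝ)..2 * Real.pi, F₁ x y) Real.pi := by
    intro x; simp only [F₁, Real.cos_add_pi, neg_sq]
  have P₂ : Function.Periodic (fun x => ∫ y in (0 : ℝ)..2 * Real.pi, F₂ x y) Real.pi := by
    intro x; simp only [F₂, Real.cos_add_pi, neg_sq]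
  have I₀ := P₀.integral_two_mul (hG hF₀ _)
  have I₁ := P₁.integral_two_mul (hG hF₁ _)
  have I₂ := P₂.integral_two_mul (hG hF₂ _)
  rw [mul_comm Real.pi 2] at I₁ I₂
  rw [show Real.pi * ((4 : ℕ) : ℝ) = 2 * Real.pi * 2 by push_cast; ring,
    show Real.pi * ((2 : ℕ) : ℝ) = 2 * Real.pi by push_cast; ring, I₀] at T₀
  rw [show Real.pi * ((1 : ℕ) : ℝ) = Real.pi by simp,
    show Real.pi * ((2 : ℕ) : ℝ) = 2 * Real.pi by push_cast; ring] at T₁ T₂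
  have T := ((T₀.const_mul (t / (8 * Real.pi ^ 2))).sub
    (T₁.const_mul (t / (4 * Real.pi ^ 2)))).sub (T₂.const_mul (t / (4 * Real.pi ^ 2)))
  change Filter.Tendsto _ _ (nhds (
    t / (4 * Real.pi ^ 2) * (∫ x in (0 : ℝ)..2 * Real.pi, ∫ y in (0 : ℝ)..2 * Real.pi, F₀ x y) -
    t / (8 * Real.pi ^ 2) * (∫ x in (0 : ℝ)..2 * Real.pi, ∫ y in (0 : ℝ)..2 * Real.pi, F₁ x y) -
    t / (8 * Real.pi ^ 2) * (∫ x in (0 : ℝ)..2 * Real.pi, ∫ y in (0 : ℝ)..2 * Real.pi, F₂ x y)))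
  rw [I₁, I₂]
  convert T.congr' ?_ using 2
  · ring
  filter_upwards [Filter.eventually_gt_atTop 0] with ℓ hℓ
  have hℓ' : (ℓ : ℝ) ≠ 0 := by positivity
  have hangle (u : ℝ) : 2 * (2 * Real.pi / ((4 * ℓ : ℕ) : ℝ) * u) = Real.pi / ℓ * u := by
    push_cast; field_simp; ring
  have hEpi : Epi (4 * ℓ) = -2 * t * ∑ n₁ ∈ Finset.range (4 * ℓ), ∑ n₂ ∈ Finset.range (2 * ℓ),
      F₀ (Real.pi / ℓ * (n₁ + 1 / 2)) (Real.pi / ℓ * (n₂ + 1 / 2)) := by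
    simp only [Epi, hangle, F₀, Finset.mul_sum, show 4 * ℓ / 2 = 2 * ℓ by omega]
  have hEstar : Estar (4 * ℓ) =
      -4 * t * (∑ n₁ ∈ Finset.range (1 * ℓ), ∑ n₂ ∈ Finset.range (2 * ℓ),
        F₁ (Real.pi / ℓ * (n₁ + 0)) (Real.pi / ℓ * (n₂ + 0))) +
      -4 * t * (∑ n₁ ∈ Finset.range (1 * ℓ), ∑ n₂ ∈ Finset.range (2 * ℓ),
        F₂ (Real.pi / ℓ * (n₁ + 0)) (Real.pi / ℓ * (n₂ + 0))) := by
    simp only [Estar, hangle, F₁, F₂, Finset.mul_sum, show 4 * ℓ / 2 = 2 * ℓ by omega,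
      show 4 * ℓ / 4 = 1 * ℓ by omega, add_zero, ← Finset.sum_add_distrib]
    refine Finset.sum_congr rfl fun _ _ => Finset.sum_congr rfl fun _ _ => ?_
    ring
  rw [hEpi, hEstar]
  generalize (∑ n₁ ∈ Finset.range (4 * ℓ), ∑ n₂ ∈ Finset.range (2 * ℓ),
    F₀ (Real.pi / ℓ * (n₁ + 1 / 2)) (Real.pi / ℓ * (n₂ + 1 / 2))) = S₀
  generalize (∑ n₁ ∈ Finset.range (1 * ℓ), ∑ n₂ ∈ Finset.range (2 * ℓ),
    F₁ (Real.pi / ℓ * (n₁ + 0)) (Real.pi / ℓ * (n₂ + 0))) = S₁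
  generalize (∑ n₁ ∈ Finset.range (1 * ℓ), ∑ n₂ ∈ Finset.range (2 * ℓ),
    F₂ (Real.pi / ℓ * (n₁ + 0)) (Real.pi / ℓ * (n₂ + 0))) = S₂
  field_simp
  ring
end
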